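/- arXiv:2311.07952 — 4 statements merged into one kernel-verified Lean document; each statement's English description precedes it below -/
import Mathlib

section
/- Suppose Assumptions 1, 2, 3, and 4 hold. Let x₀ ∈ B_cl(R/L_cl) and q₀ := Q_log(x₀). If the quantization density ρ ∈ (0,1) and the threshold parameter σ ∈ (0, σ₀] satisfy Γ L_op(1−ρ)/(1+ρ) < σ, then the first sampling time t₁ defined by the self-triggering mechanism satisfies t₁ ≥ min{τ_max, τ_min, τ̃_min} > 0. -/
set_option autoImplicit false

open Filter Set MeasureTheory Real
open scoped Topology ENNReal

noncomputable section

/-- `N` is a norm on `ℝ^n`. -/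
structure IsVecNorm {n : ℕ} (N : (Fin n → ℝ) → ℝ) : Prop where
  eq_zero : ∀ x, N x = 0 ↔ x = 0
  smul_eq : ∀ (a : ℝ) (x : Fin n → ℝ), N (a • x) = |a| * N x
  add_le : ∀ x y : Fin n → ℝ, N (x + y) ≤ N x + N y

/-- The matrix norm induced by the vector norm `N`. -/
def matNorm {n : ℕ} (N : (Fin n → ℝ) → ℝ) (A : Matrix (Fin n) (Fin n) ℝ) : ℝ :=
  sSup {c : ℝ | ∃ x : Fin n → ℝ, N x = 1 ∧ c = N (A.mulVec x)}

/-- The logarithmic norm `μ_N(A) = lim_{ε→0⁺} (‖I+εA‖_N − 1)/ε`. -/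
def logNorm {n : ℕ} (N : (Fin n → ℝ) → ℝ) (A : Matrix (Fin n) (Fin n) ℝ) : ℝ :=
  limUnder (𝓝[>] (0 : ℝ)) (fun ε : ℝ => (matNorm N (1 + ε • A) - 1) / ε)

/-- The Jacobian matrix of `F` at `x`. -/
def jacobian {n : ℕ} (F : (Fin n → ℝ) → (Fin n → ℝ)) (x : Fin n → ℝ) :
    Matrix (Fin n) (Fin n) ℝ :=
  Matrix.of fun i j => fderiv ℝ F x (Pi.single j 1) i

/-- Open ball of radius `r` centered at `0` w.r.t. the norm `N`. -/
def nball {n : ℕ} (N : (Fin n → ℝ) → ℝ) (r : ℝ) : Set (Fin n → ℝ) := {x | N x < r}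

/-- `ν(t) = d₂ ∫₀ᵗ e^{d₁ s} ds`. -/
def nu (d₁ d₂ t : ℝ) : ℝ := d₂ * ∫ s in (0:ℝ)..t, Real.exp (d₁ * s)

/-- Diagonally-weighted r-norm `‖x‖_{r,[θ]} = ‖[θ]x‖_r`. -/
def wnorm {n : ℕ} (r : ℝ≥0∞) (θ x : Fin n → ℝ) : ℝ :=
  ‖(WithLp.equiv r (∀ _ : Fin n, ℝ)).symm (fun i => θ i * x i)‖

/-- The function `ψ_log`. -/
def psiLog {n : ℕ} (Nop : (Fin n → ℝ) → ℝ) (d₁ Lop ρ : ℝ)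
    (X : (Fin n → ℝ) → ℝ → (Fin n → ℝ)) (s : ℝ) (q : Fin n → ℝ) : ℝ :=
  Lop * (1 - ρ) / (1 + ρ) * Real.exp (d₁ * s) * Nop q + Nop (X q s - q)

open Classical in
/-- The time `τ̃_k` of the self-triggering mechanism. -/
def tauTilde {n : ℕ} (Nop : (Fin n → ℝ) → ℝ) (R₂ τmax : ℝ)
    (X : (Fin n → ℝ) → ℝ → (Fin n → ℝ)) (q : Fin n → ℝ) : ℝ :=
  if ∀ s ∈ Set.Ioo (0:ℝ) τmax, Nop (X q s) < R₂ then τmax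
  else sInf {s : ℝ | 0 < s ∧ R₂ ≤ Nop (X q s)}

open Classical in
/-- The inter-sampling time `τ_k` of the self-triggering mechanism. -/
def tauSamp {n : ℕ} (Ncl Nop : (Fin n → ℝ) → ℝ) (R₂ τmax σ d₁ Lop ρ : ℝ)
    (X : (Fin n → ℝ) → ℝ → (Fin n → ℝ)) (q : Fin n → ℝ) : ℝ :=
  if ∀ s ∈ Set.Ioo (0:ℝ) (tauTilde Nop R₂ τmax X q), psiLog Nop d₁ Lop ρ X s q ≤ σ * Ncl q
  then tauTilde Nop R₂ τmax X q
  else sInf {s : ℝ | 0 < s ∧ σ * Ncl q < psiLog Nop d₁ Lop ρ X s q}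

lemma vn_zero {n : ℕ} {N : (Fin n → ℝ) → ℝ} (h : IsVecNorm N) : N 0 = 0 := (h.eq_zero 0).2 rfl

lemma vn_neg {n : ℕ} {N : (Fin n → ℝ) → ℝ} (h : IsVecNorm N) (x : Fin n → ℝ) : N (-x) = N x := by
  have := h.smul_eq (-1) x
  simpa using this

lemma vn_nonneg {n : ℕ} {N : (Fin n → ℝ) → ℝ} (h : IsVecNorm N) (x : Fin n → ℝ) : 0 ≤ N x := by
  have h1 := h.add_le x (-x)
  rw [vn_neg h, add_neg_cancel, vn_zero h] at h1
  linarith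

lemma vn_bound {n : ℕ} {N : (Fin n → ℝ) → ℝ} (h : IsVecNorm N) :
    ∃ C : ℝ, 0 ≤ C ∧ ∀ x, N x ≤ C * ‖x‖ := by
  have hsum : ∀ (s : Finset (Fin n)) (F : Fin n → (Fin n → ℝ)),
      N (∑ i ∈ s, F i) ≤ ∑ i ∈ s, N (F i) := by
    intro s F
    classical
    induction s using Finset.induction_on with
    | empty => simp [vn_zero h]
    | insert a s ha ih =>
      rw [Finset.sum_insert ha, Finset.sum_insert ha]
      exact (h.add_le _ _).trans (by linarith)
  refine ⟨∑ i, N (Pi.single i 1), Finset.sum_nonneg (fun i _ => vn_nonneg h _), fun x => ?_⟩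
  have hx : x = ∑ i, x i • (Pi.single i (1:ℝ) : Fin n → ℝ) := by
    ext j
    simp [Finset.sum_apply, Pi.single_apply]
  calc N x = N (∑ i, x i • (Pi.single i (1:ℝ) : Fin n → ℝ)) := by rw [← hx]
    _ ≤ ∑ i, N (x i • (Pi.single i (1:ℝ) : Fin n → ℝ)) := hsum _ _
    _ ≤ ∑ i, N (Pi.single i 1) * ‖x‖ := by
        refine Finset.sum_le_sum fun i _ => ?_
        rw [h.smul_eq, mul_comm]
        exact mul_le_mul_of_nonneg_left (norm_le_pi_norm x i) (vn_nonneg h _)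
    _ = _ := by rw [Finset.sum_mul]

lemma vn_cont {n : ℕ} {N : (Fin n → ℝ) → ℝ} (h : IsVecNorm N) : Continuous N := by
  obtain ⟨C, hC, hb⟩ := vn_bound h
  refine LipschitzWith.continuous (K := ⟨C, hC⟩) (LipschitzWith.of_le_add_mul _ fun x y => ?_)
  have h1 := h.add_le y (x - y)
  have h2 := hb (x - y)
  rw [add_sub_cancel] at h1
  rw [dist_eq_norm]
  exact h1.trans (add_le_add_right h2 _)

/-- boundedness of the set defining the matrix norm -/
lemma mn_bdd {n : ℕ} {N : (Fin n → ℝ) → ℝ} (h : IsVecNorm N) {K : ℝ}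
    (hK : ∀ x : Fin n → ℝ, ‖x‖ ≤ K * N x) (A : Matrix (Fin n) (Fin n) ℝ) :
    BddAbove {c : ℝ | ∃ x : Fin n → ℝ, N x = 1 ∧ c = N (A.mulVec x)} := by
  obtain ⟨C, hC, hb⟩ := vn_bound h
  refine ⟨C * (‖LinearMap.toContinuousLinearMap (Matrix.toLin' A)‖ * K), ?_⟩
  rintro c ⟨x, hx, rfl⟩
  refine (hb _).trans (mul_le_mul_of_nonneg_left ?_ hC)
  have h1 := (LinearMap.toContinuousLinearMap (Matrix.toLin' A)).le_opNorm x
  have h2 := hK x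
  rw [hx, mul_one] at h2
  refine le_trans ?_ (h1.trans (mul_le_mul_of_nonneg_left h2 (norm_nonneg _)))
  simp

lemma mn_le {n : ℕ} {N : (Fin n → ℝ) → ℝ} (h : IsVecNorm N) {K : ℝ}
    (hK : ∀ x : Fin n → ℝ, ‖x‖ ≤ K * N x) (A : Matrix (Fin n) (Fin n) ℝ) (v : Fin n → ℝ) :
    N (A.mulVec v) ≤ matNorm N A * N v := by
  by_cases hv : v = 0
  · subst hv; simp [vn_zero h]
  have hpos : 0 < N v := lt_of_le_of_ne (vn_nonneg h v) (fun h0 => hv ((h.eq_zero v).1 h0.symm))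
  have h1 : N (A.mulVec ((N v)⁻¹ • v)) ≤ matNorm N A := by
    refine le_csSup (mn_bdd h hK A) ⟨_, ?_, rfl⟩
    rw [h.smul_eq, abs_of_pos (inv_pos.2 hpos), inv_mul_cancel₀ hpos.ne']
  rw [Matrix.mulVec_smul, h.smul_eq, abs_of_pos (inv_pos.2 hpos), inv_mul_le_iff₀ hpos] at h1
  linarith

lemma vn_unit {n : ℕ} (hn : 0 < n) {N : (Fin n → ℝ) → ℝ} (h : IsVecNorm N) : ∃ x, N x = 1 := by
  let v : Fin n → ℝ := fun _ => 1
  have hv : v ≠ 0 := fun h0 => by simpa [v] using congrFun h0 ⟨0, hn⟩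
  have hpos : 0 < N v := lt_of_le_of_ne (vn_nonneg h v) (fun h0 => hv ((h.eq_zero v).1 h0.symm))
  exact ⟨(N v)⁻¹ • v, by
    rw [h.smul_eq, abs_of_pos (inv_pos.2 hpos), inv_mul_cancel₀ hpos.ne']⟩

lemma logNorm_tendsto {n : ℕ} (hn : 0 < n) {N : (Fin n → ℝ) → ℝ} (h : IsVecNorm N) {K : ℝ}
    (hK : ∀ x : Fin n → ℝ, ‖x‖ ≤ K * N x) (A : Matrix (Fin n) (Fin n) ℝ) :
    Tendsto (fun ε : ℝ => (matNorm N (1 + ε • A) - 1) / ε) (𝓝[>] (0 : ℝ)) (𝓝 (logNorm N A)) := by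
  obtain ⟨x, hx⟩ := vn_unit hn h
  have hmv : ∀ (ε : ℝ) (y : Fin n → ℝ), (1 + ε • A).mulVec y = y + ε • A.mulVec y := by
    intro ε y
    rw [Matrix.add_mulVec, Matrix.one_mulVec, Matrix.smul_mulVec]
  have hmono : MonotoneOn (fun ε : ℝ => (matNorm N (1 + ε • A) - 1) / ε) (Ioi 0) := by
    intro a ha b hb hab
    have ha' : (0:ℝ) < a := ha
    have hb' : (0:ℝ) < b := hb
    have key : matNorm N (1 + a • A) ≤ (1 - a / b) + a / b * matNorm N (1 + b • A) := by
      refine csSup_le ⟨_, x, hx, rfl⟩ ?_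
      rintro c ⟨y, hy, rfl⟩
      have e1 : (1 + a • A).mulVec y = (1 - a / b) • y + (a / b) • (1 + b • A).mulVec y := by
        rw [hmv, hmv, smul_add, smul_smul, div_mul_cancel₀ _ hb'.ne', ← add_assoc, ← add_smul]
        simp
      have h1 := mn_le h hK (1 + b • A) y
      rw [hy, mul_one] at h1
      have h2 : 0 ≤ a / b := by positivity
      have h3 : 0 ≤ 1 - a / b := by rw [sub_nonneg, div_le_one hb']; exact hab
      rw [e1]
      refine (h.add_le _ _).trans ?_
      rw [h.smul_eq, h.smul_eq, abs_of_nonneg h2, abs_of_nonneg h3, hy, mul_one]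
      have := mul_le_mul_of_nonneg_left h1 h2
      linarith
    show (matNorm N (1 + a • A) - 1) / a ≤ (matNorm N (1 + b • A) - 1) / b
    rw [div_le_iff₀ ha']
    calc matNorm N (1 + a • A) - 1 ≤ (1 - a / b) + a / b * matNorm N (1 + b • A) - 1 := by linarith
      _ = _ := by field_simp; ring
  have hbdd : BddBelow ((fun ε : ℝ => (matNorm N (1 + ε • A) - 1) / ε) '' (Ioi 0)) := by
    refine ⟨-N (A.mulVec x), ?_⟩
    rintro _ ⟨a, ha, rfl⟩
    have ha' : (0:ℝ) < a := ha
    show _ ≤ (matNorm N (1 + a • A) - 1) / a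
    rw [le_div_iff₀ ha']
    have h1 := mn_le h hK (1 + a • A) x
    have h2 := h.add_le (x + a • A.mulVec x) (-(a • A.mulVec x))
    rw [vn_neg h, h.smul_eq, abs_of_pos ha', add_neg_cancel_right, hx] at h2
    rw [hmv, hx] at h1
    linarith
  exact tendsto_nhds_limUnder ⟨_, hmono.tendsto_nhdsGT hbdd⟩

/-- Supporting functional. -/
lemma exists_support {n : ℕ} {N : (Fin n → ℝ) → ℝ} (h : IsVecNorm N) (v : Fin n → ℝ)
    (hv : v ≠ 0) : ∃ l : (Fin n → ℝ) →L[ℝ] ℝ, l v = N v ∧ ∀ x, l x ≤ N x := by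
  obtain ⟨g, hg1, hg2⟩ := exists_extension_of_le_sublinear
    (LinearPMap.mkSpanSingleton (K := ℝ) v (N v) hv) N
    (fun c hc x => by rw [h.smul_eq, abs_of_pos hc]) h.add_le (by
      rintro ⟨y, hy⟩
      obtain ⟨a, rfl⟩ := Submodule.mem_span_singleton.1 hy
      have e : (LinearPMap.mkSpanSingleton (K := ℝ) v (N v) hv) ⟨a • v, hy⟩ = a • N v :=
        LinearPMap.mkSpanSingleton'_apply _ _ _ _ _
      refine e.trans_le ?_
      show a • N v ≤ N (a • v)
      rw [h.smul_eq]
      exact mul_le_mul_of_nonneg_right (le_abs_self a) (vn_nonneg h v))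
  refine ⟨LinearMap.toContinuousLinearMap g, ?_, hg2⟩
  have := hg1 ⟨v, Submodule.mem_span_singleton_self v⟩
  exact this.trans (LinearPMap.mkSpanSingleton'_apply_self _ _ _ _)

lemma support_logNorm {n : ℕ} (hn : 0 < n) {N : (Fin n → ℝ) → ℝ} (h : IsVecNorm N) {K : ℝ}
    (hK : ∀ x : Fin n → ℝ, ‖x‖ ≤ K * N x) (A : Matrix (Fin n) (Fin n) ℝ)
    (v : Fin n → ℝ) (l : (Fin n → ℝ) →L[ℝ] ℝ) (hl : l v = N v) (hl2 : ∀ x, l x ≤ N x) :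
    l (A.mulVec v) ≤ logNorm N A * N v := by
  refine ge_of_tendsto ((logNorm_tendsto hn h hK A).mul_const (N v)) ?_
  filter_upwards [self_mem_nhdsWithin] with ε hε
  have hε' : (0:ℝ) < ε := hε
  have h1 := (hl2 _).trans (mn_le h hK (1 + ε • A) v)
  rw [Matrix.add_mulVec, Matrix.one_mulVec, Matrix.smul_mulVec, map_add, map_smul, hl,
    smul_eq_mul] at h1
  rw [div_mul_eq_mul_div, le_div_iff₀ hε']
  linarith

lemma jacobian_mulVec {n : ℕ} (F : (Fin n → ℝ) → (Fin n → ℝ)) (x v : Fin n → ℝ) :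
    (jacobian F x).mulVec v = fderiv ℝ F x v := by
  have hx : v = ∑ i, v i • (Pi.single i (1:ℝ) : Fin n → ℝ) := by
    ext j
    simp [Finset.sum_apply, Pi.single_apply]
  ext i
  conv_rhs => rw [hx]
  simp [jacobian, Matrix.mulVec, dotProduct, map_sum, Finset.sum_apply, mul_comm]

lemma nball_open {n : ℕ} {N : (Fin n → ℝ) → ℝ} (h : IsVecNorm N) (r : ℝ) : IsOpen (nball N r) :=
  isOpen_lt (vn_cont h) continuous_const

lemma support_diff {n : ℕ} (hn : 0 < n) {N : (Fin n → ℝ) → ℝ} (h : IsVecNorm N) {K : ℝ}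
    (hK : ∀ x : Fin n → ℝ, ‖x‖ ≤ K * N x) (F : (Fin n → ℝ) → (Fin n → ℝ)) (r d : ℝ)
    (hF : ContDiffOn ℝ 1 F (nball N r)) (hmu : ∀ x ∈ nball N r, logNorm N (jacobian F x) ≤ d)
    (q x : Fin n → ℝ) (hq : q ∈ nball N r) (hx : x ∈ nball N r)
    (l : (Fin n → ℝ) →L[ℝ] ℝ) (hl : l (x - q) = N (x - q)) (hl2 : ∀ x, l x ≤ N x) :
    l (F x - F q) ≤ d * N (x - q) := by
  have hmem : ∀ t ∈ Icc (0:ℝ) 1, q + t • (x - q) ∈ nball N r := by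
    intro t ht
    have e : q + t • (x - q) = (1 - t) • q + t • x := by
      rw [smul_sub, sub_smul, one_smul]; abel
    have h1 := h.add_le ((1 - t) • q) (t • x)
    rw [h.smul_eq, h.smul_eq, abs_of_nonneg ht.1, abs_of_nonneg (sub_nonneg.2 ht.2)] at h1
    show N _ < r
    rw [e]
    have hq' : N q < r := hq
    have hx' : N x < r := hx
    refine h1.trans_lt ?_
    rcases eq_or_lt_of_le ht.1 with h0 | h0
    · rw [← h0]; simpa using hq'
    · nlinarith [mul_lt_mul_of_pos_left hx' h0, mul_le_mul_of_nonneg_left hq'.le (sub_nonneg.2 ht.2)]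
  have hder : ∀ t ∈ Icc (0:ℝ) 1, HasDerivAt (fun t : ℝ => l (F (q + t • (x - q))))
      (l (fderiv ℝ F (q + t • (x - q)) (x - q))) t := by
    intro t ht
    have hd : DifferentiableAt ℝ F (q + t • (x - q)) :=
      (hF.contDiffAt ((nball_open h r).mem_nhds (hmem t ht))).differentiableAt one_ne_zero
    have h1 : HasDerivAt (fun t : ℝ => q + t • (x - q)) (x - q) t := by
      simpa using ((hasDerivAt_id t).smul_const (x - q)).const_add q
    exact l.hasFDerivAt.comp_hasDerivAt t (hd.hasFDerivAt.comp_hasDerivAt t h1)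
  obtain ⟨t, ht, he⟩ := exists_hasDerivAt_eq_slope (fun t : ℝ => l (F (q + t • (x - q))))
    (fun t => l (fderiv ℝ F (q + t • (x - q)) (x - q))) zero_lt_one
    (fun t ht => (hder t ht).continuousAt.continuousWithinAt)
    (fun t ht => hder t (Ioo_subset_Icc_self ht))
  have h1 := support_logNorm hn h hK (jacobian F (q + t • (x - q))) (x - q) l hl hl2
  rw [jacobian_mulVec, he] at h1
  simp only [one_smul, zero_smul, add_zero, add_sub_cancel, sub_zero, div_one, ← map_sub] at h1
  exact h1.trans (mul_le_mul_of_nonneg_right (hmu _ (hmem t (Ioo_subset_Icc_self ht)))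
    (vn_nonneg h _))

lemma crossing (W B : ℝ → ℝ) (T : ℝ) (hW : Continuous W) (hB : Continuous B) (h0 : W 0 < B 0)
    (h : ∀ s, 0 < s → s ≤ T → W s = B s → ∃ (u : ℝ → ℝ) (u' B' : ℝ), HasDerivAt u u' s ∧
      HasDerivAt B B' s ∧ u' < B' ∧ (∀ t, u t ≤ W t) ∧ u s = W s) :
    ∀ s ∈ Icc (0:ℝ) T, W s < B s := by
  by_contra! hcon
  obtain ⟨s₁, hs₁, hs₁'⟩ := hcon
  have hcomp : IsCompact (Icc (0:ℝ) T ∩ {s | B s ≤ W s}) :=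
    isCompact_Icc.inter_right (isClosed_le hB hW)
  obtain ⟨s, ⟨hs, hsW⟩, hleast⟩ := hcomp.exists_isLeast ⟨s₁, hs₁, hs₁'⟩
  have hsW' : B s ≤ W s := hsW
  have hspos : 0 < s := lt_of_le_of_ne hs.1 (fun e => by rw [← e] at hsW'; linarith)
  have hlt : ∀ t, 0 ≤ t → t < s → W t < B t := by
    intro t ht hts
    by_contra! hc
    exact absurd (hleast ⟨⟨ht, hts.le.trans hs.2⟩, hc⟩) (not_le.2 hts)
  have hev : ∀ᶠ t in 𝓝[<] s, 0 ≤ t ∧ t < s := by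
    filter_upwards [Ioo_mem_nhdsLT hspos] with t ht using ⟨ht.1.le, ht.2⟩
  have heq : W s = B s := by
    refine le_antisymm ?_ hsW'
    refine le_of_tendsto_of_tendsto (hW.continuousWithinAt (s := Iio s)) (hB.continuousWithinAt (s := Iio s)) ?_
    filter_upwards [hev] with t ht using (hlt t ht.1 ht.2).le
  obtain ⟨u, u', B', hu, hB', hlt', hle, hus⟩ := h s hspos hs.2 heq
  have hd := (hu.sub hB').hasDerivWithinAt (s := Iio s)
  rw [hasDerivWithinAt_iff_tendsto_slope' (by simp)] at hd
  have : 0 ≤ u' - B' := by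
    refine ge_of_tendsto hd ?_
    filter_upwards [hev] with t ht
    rw [slope_def_field]
    have h1 := hlt t ht.1 ht.2
    have h2 := hle t
    refine div_nonneg_of_nonpos ?_ (by linarith [ht.2])
    simp only [Pi.sub_apply]
    linarith
  linarith

lemma E_deriv (d t : ℝ) :
    HasDerivAt (fun t => ∫ s in (0:ℝ)..t, Real.exp (d * s)) (Real.exp (d * t)) t := by
  have hc : Continuous fun s : ℝ => Real.exp (d * s) := by fun_prop
  exact intervalIntegral.integral_hasDerivAt_right (hc.intervalIntegrable _ _)
    hc.stronglyMeasurable.stronglyMeasurableAtFilter hc.continuousAt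

lemma E_eq (d t : ℝ) : d * (∫ s in (0:ℝ)..t, Real.exp (d * s)) + 1 = Real.exp (d * t) := by
  have hc : Continuous fun s : ℝ => Real.exp (d * s) * d := by fun_prop
  have h1 := intervalIntegral.integral_eq_sub_of_hasDerivAt (a := 0) (b := t)
    (f := fun s => Real.exp (d * s)) (f' := fun s => Real.exp (d * s) * d)
    (fun x _ => by simpa using ((hasDerivAt_id x).const_mul d).exp) (hc.intervalIntegrable _ _)
  rw [intervalIntegral.integral_mul_const] at h1
  simp at h1
  linarith

lemma E_mono (d : ℝ) : Monotone (fun t => ∫ s in (0:ℝ)..t, Real.exp (d * s)) :=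
  monotone_of_deriv_nonneg (fun t => (E_deriv d t).differentiableAt)
    (fun t => by rw [(E_deriv d t).deriv]; positivity)

/-- Growth bound along the open-loop trajectory. -/
lemma growth {n : ℕ} (hn : 0 < n) {N : (Fin n → ℝ) → ℝ} (h : IsVecNorm N) {K : ℝ}
    (hK : ∀ x : Fin n → ℝ, ‖x‖ ≤ K * N x) (F : (Fin n → ℝ) → (Fin n → ℝ)) (r d d₂ : ℝ)
    (hd : 0 ≤ d) (hd₂ : 0 < d₂)
    (hF : ContDiffOn ℝ 1 F (nball N r)) (hmu : ∀ x ∈ nball N r, logNorm N (jacobian F x) ≤ d)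
    (q : Fin n → ℝ) (hq : q ∈ nball N r) (hFq : N (F q) ≤ d₂ * N q)
    (x : ℝ → (Fin n → ℝ)) (hxc : Continuous x) (hx0 : x 0 = q)
    (hxd : ∀ s, 0 ≤ s → N (x s) < r → HasDerivWithinAt x (F (x s)) (Ici 0) s)
    (T : ℝ) (hT : N q * (1 + nu d d₂ T) < r) :
    ∀ s ∈ Icc (0:ℝ) T, N (x s - q) ≤ nu d d₂ s * N q := by
  intro s hs
  set E : ℝ → ℝ := fun t => ∫ s in (0:ℝ)..t, Real.exp (d * s) with hE
  have hEd : ∀ t, HasDerivAt E (Real.exp (d * t)) t := E_deriv d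
  have hEe : ∀ t, d * E t + 1 = Real.exp (d * t) := E_eq d
  have hEm : Monotone E := E_mono d
  have hE0 : E 0 = 0 := by simp [hE]
  have hnu : ∀ t, nu d d₂ t = d₂ * E t := fun t => rfl
  rw [hnu] at hT
  rw [hnu]
  let B : ℝ → ℝ → ℝ := fun ε t => ε * Real.exp (d * t) + (d₂ * N q + ε) * E t
  have hBε : ∀ t, Continuous fun ε => B ε t := fun t => by fun_prop
  have hB0 : ∀ t, B 0 t = d₂ * E t * N q := fun t => by simp only [B]; ring
  have hev : ∀ᶠ ε in 𝓝[>] (0:ℝ), N q + B ε T < r := by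
    have : ∀ᶠ ε in 𝓝 (0:ℝ), N q + B ε T < r := by
      refine (continuous_const.add (hBε T)).continuousAt.eventually_lt_const ?_
      show N q + B 0 T < r
      rw [hB0]; linarith
    exact this.filter_mono nhdsWithin_le_nhds
  have hmain : ∀ᶠ ε in 𝓝[>] (0:ℝ), N (x s - q) ≤ B ε s := by
    filter_upwards [hev, self_mem_nhdsWithin] with ε hε hεpos
    have hε0 : (0:ℝ) < ε := hεpos
    have hBd : ∀ t, HasDerivAt (B ε) (d * B ε t + (d₂ * N q + ε)) t := by
      intro t
      have h1 : HasDerivAt (fun t => Real.exp (d * t)) (Real.exp (d * t) * d) t := by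
        simpa using ((hasDerivAt_id t).const_mul d).exp
      have h2 := (h1.const_mul ε).add ((hEd t).const_mul (d₂ * N q + ε))
      refine h2.congr_deriv ?_
      simp only [B]
      rw [← hEe]; ring
    have hNq := vn_nonneg h q
    refine (crossing (fun t => N (x t - q)) (B ε) T ((vn_cont h).comp (hxc.sub continuous_const))
      (continuous_iff_continuousAt.2 fun t => (hBd t).continuousAt) ?_ ?_ s hs).le
    · simp [B, hx0, vn_zero h, hE0, hε0]
    · intro t ht htT hWB
      have hEt : 0 ≤ E t := hE0 ▸ hEm ht.le
      have hBpos : 0 < B ε t := by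
        simp only [B]; positivity
      have hBmono : B ε t ≤ B ε T := by
        simp only [B]
        have : Real.exp (d * t) ≤ Real.exp (d * T) := by gcongr
        have h3 : E t ≤ E T := hEm htT
        gcongr
      have hxr : N (x t) < r := by
        have := h.add_le q (x t - q)
        rw [add_sub_cancel] at this
        linarith
      have hvne : x t - q ≠ 0 := by
        intro h0
        simp only [h0, vn_zero h] at hWB
        linarith
      obtain ⟨l, hl, hl2⟩ := exists_support h _ hvne
      refine ⟨fun t => l (x t - q), l (F (x t)), _, ?_, hBd t, ?_, fun t => hl2 _, hl⟩
      · have h1 : HasDerivAt x (F (x t)) t := (hxd t ht.le hxr).hasDerivAt (Ici_mem_nhds ht)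
        exact l.hasFDerivAt.comp_hasDerivAt t (h1.sub_const q)
      · have h1 := support_diff hn h hK F r d hF hmu q (x t) hq hxr l hl hl2
        have h2 := hl2 (F q)
        rw [map_sub] at h1
        rw [hWB] at h1
        linarith
  have hlim : Tendsto (fun ε => B ε s) (𝓝[>] (0:ℝ)) (𝓝 (B 0 s)) :=
    (hBε s).continuousAt.tendsto.mono_left nhdsWithin_le_nhds
  rw [← hB0]
  exact ge_of_tendsto hlim hmain

lemma wnorm_ge {n : ℕ} (r : ℝ≥0∞) (hr : 1 ≤ r) (θ x : Fin n → ℝ) (i : Fin n) :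
    |θ i * x i| ≤ wnorm r θ x := by
  have : Fact (1 ≤ r) := ⟨hr⟩
  exact PiLp.norm_apply_le (p := r) (WithLp.toLp r (fun i => θ i * x i)) i

lemma wnorm_top_le {n : ℕ} (θ x : Fin n → ℝ) (b : ℝ) (hb : 0 ≤ b) (h : ∀ i, |θ i * x i| ≤ b) :
    wnorm ⊤ θ x ≤ b := by
  have : wnorm ⊤ θ x = ‖(fun i => θ i * x i : Fin n → ℝ)‖ := PiLp.norm_toLp _
  rw [this]
  exact (pi_norm_le_iff_of_nonneg hb).2 h

set_option maxHeartbeats 2000000 in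
theorem stmt11
    {n m : ℕ} (hn : 0 < n) (hm : 0 < m)
    (f : (Fin n → ℝ) → (Fin m → ℝ) → (Fin n → ℝ)) (g : (Fin n → ℝ) → (Fin m → ℝ))
    (hf : Continuous (fun p : (Fin n → ℝ) × (Fin m → ℝ) => f p.1 p.2)) (hg : Continuous g)
    (hf0 : f 0 (g 0) = 0)
    -- Assumption 1
    (Ncl : (Fin n → ℝ) → ℝ) (hNcl : IsVecNorm Ncl) (c R₁ : ℝ) (hc : 0 < c) (hR₁ : 0 < R₁)
    (hLip : ∀ x ∈ nball Ncl R₁, ∃ (K : NNReal) (ε : ℝ), 0 < ε ∧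
      LipschitzOnWith K (fun y => f y (g y)) (Metric.ball x ε ∩ nball Ncl R₁))
    (hmucl : ∀ᵐ x ∂(volume : Measure (Fin n → ℝ)), x ∈ nball Ncl R₁ →
      DifferentiableAt ℝ (fun y => f y (g y)) x ∧
      logNorm Ncl (jacobian (fun y => f y (g y)) x) ≤ -c)
    -- Assumption 2
    (Nop : (Fin n → ℝ) → ℝ) (hNop : IsVecNorm Nop) (d₁ d₂ R₂ : ℝ)
    (hd₁ : 0 ≤ d₁) (hd₂ : 0 < d₂) (hR₂ : 0 < R₂)
    (hC1 : ∀ q ∈ nball Nop R₂, ContDiffOn ℝ 1 (fun x => f x (g q)) (nball Nop R₂))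
    (hmuop : ∀ q ∈ nball Nop R₂, ∀ x ∈ nball Nop R₂,
      logNorm Nop (jacobian (fun y => f y (g q)) x) ≤ d₁)
    (hfqq : ∀ q ∈ nball Nop R₂, Nop (f q (g q)) ≤ d₂ * Nop q)
    -- the constants Γ and R
    (Γ R : ℝ) (hΓ : 0 < Γ) (hΓle : ∀ x : Fin n → ℝ, Nop x ≤ Γ * Ncl x)
    (hR : R = min R₁ (R₂ / Γ))
    -- Assumption 3
    (α σ₀ : ℝ) (hα : 0 < α) (hσ₀ : 0 < σ₀)
    (hFLip : ∀ x ∈ nball Ncl R, ∀ e ∈ nball Nop (σ₀ * R),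
      Ncl (f x (g (x + e)) - f x (g x)) ≤ α * Nop e)
    -- equivalence of ‖·‖_cl with a diagonally-weighted ∞-norm
    (θcl : Fin n → ℝ) (hθcl : ∀ i, 0 < θcl i)
    (Lcl1 Lcl2 : ℝ) (hLcl1 : 0 < Lcl1) (hLcl2 : 0 < Lcl2)
    (hclEquiv : ∀ x : Fin n → ℝ,
      Lcl1 * wnorm ⊤ θcl x ≤ Ncl x ∧ Ncl x ≤ Lcl2 * wnorm ⊤ θcl x)
    (Lcl : ℝ) (hLcl : Lcl = Lcl2 / Lcl1)
    -- equivalence of ‖·‖_op with a diagonally-weighted r-norm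
    (θop : Fin n → ℝ) (hθop : ∀ i, 0 < θop i) (r : ℝ≥0∞) (hr : 1 ≤ r)
    (Lop1 Lop2 : ℝ) (hLop1 : 0 < Lop1) (hLop2 : 0 < Lop2)
    (hopEquiv : ∀ x : Fin n → ℝ,
      Lop1 * wnorm r θop x ≤ Nop x ∧ Nop x ≤ Lop2 * wnorm r θop x)
    (Lop : ℝ) (hLop : Lop = Lop2 / Lop1)
    (ρ : ℝ) (hρ : 0 < ρ ∧ ρ < 1)
    -- Assumption 4
    (χ₀ : ℝ) (hχ₀pos : 0 < χ₀) (hχ₀ : R / Lcl2 ≤ χ₀ ∧ χ₀ < 2 * R / (Lcl2 * (1 + ρ)))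
    -- the logarithmic quantizer with density ρ and parameters χ_{i,0} = χ₀ / θcl i
    (Qlog : (Fin n → ℝ) → (Fin n → ℝ))
    (hQ0 : ∀ (x : Fin n → ℝ) (i : Fin n), x i = 0 → Qlog x i = 0)
    (hQpos : ∀ (x : Fin n → ℝ) (i : Fin n) (j : ℤ),
      ρ ^ (j + 1) * (χ₀ / θcl i) ≤ x i → x i < ρ ^ j * (χ₀ / θcl i) →
      Qlog x i = (ρ ^ j * (χ₀ / θcl i) + ρ ^ (j + 1) * (χ₀ / θcl i)) / 2)
    (hQneg : ∀ (x : Fin n → ℝ) (i : Fin n), x i < 0 → Qlog x i = - Qlog (-x) i)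
    -- `X q` is the (predicted) trajectory of the open-loop system starting at `q`
    (X : (Fin n → ℝ) → ℝ → (Fin n → ℝ))
    (hX : ∀ qq : Fin n → ℝ, Continuous (X qq) ∧ X qq 0 = qq ∧
      ∀ s : ℝ, 0 ≤ s → Nop (X qq s) < R₂ →
        HasDerivWithinAt (X qq) (f (X qq s) (g qq)) (Set.Ici 0) s)
    (σ : ℝ) (hσpos : 0 < σ) (hσub : σ ≤ σ₀)
    (hcond : Γ * Lop * (1 - ρ) / (1 + ρ) < σ)
    (τmax : ℝ) (hτmax : 0 < τmax)
    (τmin : ℝ) (hτmin : 0 < τmin ∧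
      Lop * (1 - ρ) / (1 + ρ) * Real.exp (d₁ * τmin) + nu d₁ d₂ τmin = σ / Γ)
    (lam : ℝ) (hlam : (1 + ρ) * Lcl2 * χ₀ / (2 * R) < lam ∧ lam < 1)
    (τtmin : ℝ) (hτtmin : 0 < τtmin ∧ lam * (1 + nu d₁ d₂ τtmin) = 1)
    (x₀ : Fin n → ℝ) (hx₀ : Ncl x₀ < R / Lcl) :
    0 < min τmax (min τmin τtmin) ∧
    min τmax (min τmin τtmin) ≤ tauSamp Ncl Nop R₂ τmax σ d₁ Lop ρ X (Qlog x₀) := by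
  have hρ0 := hρ.1
  have hρ1 := hρ.2
  have hRpos : 0 < R := by rw [hR]; exact lt_min hR₁ (div_pos hR₂ hΓ)
  have hΓR : Γ * R ≤ R₂ := by
    have : R ≤ R₂ / Γ := by rw [hR]; exact min_le_right _ _
    rw [le_div_iff₀ hΓ] at this; linarith
  have hpos : 0 < min τmax (min τmin τtmin) := lt_min hτmax (lt_min hτmin.1 hτtmin.1)
  refine ⟨hpos, ?_⟩
  -- equivalence constant
  obtain ⟨K, hK⟩ : ∃ K : ℝ, ∀ x : Fin n → ℝ, ‖x‖ ≤ K * Nop x := by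
    have hS : ∀ i, 1 / (Lop1 * θop i) ≤ ∑ i, 1 / (Lop1 * θop i) := fun i =>
      Finset.single_le_sum (f := fun i => 1 / (Lop1 * θop i))
        (fun j _ => (one_div_pos.2 (mul_pos hLop1 (hθop j))).le) (Finset.mem_univ i)
    have hS0 : 0 ≤ ∑ i, 1 / (Lop1 * θop i) :=
      Finset.sum_nonneg (fun j _ => (one_div_pos.2 (mul_pos hLop1 (hθop j))).le)
    refine ⟨∑ i, 1 / (Lop1 * θop i), fun x => ?_⟩
    refine (pi_norm_le_iff_of_nonneg (mul_nonneg hS0 (vn_nonneg hNop x))).2 fun i => ?_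
    refine le_trans ?_ (mul_le_mul_of_nonneg_right (hS i) (vn_nonneg hNop x))
    have h1 := wnorm_ge r hr θop x i
    rw [abs_mul, abs_of_pos (hθop i)] at h1
    have h2 := (hopEquiv x).1
    rw [div_mul_eq_mul_div, one_mul, le_div_iff₀ (mul_pos hLop1 (hθop i)), Real.norm_eq_abs]
    nlinarith [mul_le_mul_of_nonneg_left h1 hLop1.le]
  -- quantizer bound
  have hQp : ∀ (x : Fin n → ℝ) (i : Fin n), 0 < x i → x i < χ₀ / θcl i →
      |Qlog x i| ≤ (1 + ρ) / 2 * (χ₀ / θcl i) := by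
    intro x i hx hxlt
    have ha : 0 < χ₀ / θcl i := div_pos hχ₀pos (hθcl i)
    set a := χ₀ / θcl i with hadef
    obtain ⟨k, hk1, hk2⟩ := exists_mem_Ico_zpow (div_pos hx ha) (one_lt_inv₀ hρ0 |>.2 hρ1)
    rw [inv_zpow', le_div_iff₀ ha] at hk1
    rw [inv_zpow', div_lt_iff₀ ha] at hk2
    have hj : (-(k+1)) + 1 = -k := by ring
    have hQ := hQpos x i (-(k+1)) (by rw [hj]; exact hk1) hk2
    have hklt : ρ ^ (-k) < 1 := by
      by_contra! hc
      have := mul_le_mul_of_nonneg_right hc ha.le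
      linarith
    have hk0 : 0 ≤ -(k+1) := by
      by_contra! hc
      have : ρ ^ (0:ℤ) ≤ ρ ^ (-k) := zpow_le_zpow_right_of_le_one₀ hρ0 hρ1.le (by omega)
      rw [zpow_zero] at this
      linarith
    have hle : ρ ^ (-(k+1)) ≤ 1 := by
      have : ρ ^ (-(k+1)) ≤ ρ ^ (0:ℤ) := zpow_le_zpow_right_of_le_one₀ hρ0 hρ1.le hk0
      simpa using this
    have hpp : 0 < ρ ^ (-(k+1)) := zpow_pos hρ0 _
    rw [hQ, zpow_add_one₀ hρ0.ne', abs_of_nonneg (by positivity)]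
    have : ρ ^ (-(k+1)) * ((1 + ρ) / 2 * a) ≤ 1 * ((1 + ρ) / 2 * a) :=
      mul_le_mul_of_nonneg_right hle (by positivity)
    linarith
  have hQall : ∀ (x : Fin n → ℝ) (i : Fin n), |x i| < χ₀ / θcl i →
      |Qlog x i| ≤ (1 + ρ) / 2 * (χ₀ / θcl i) := by
    intro x i hx
    rcases lt_trichotomy (x i) 0 with h | h | h
    · rw [hQneg x i h, abs_neg]
      rw [abs_of_neg h] at hx
      exact hQp (-x) i (by simpa using h) (by simpa using hx)
    · rw [hQ0 x i h, abs_zero]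
      have := div_pos hχ₀pos (hθcl i)
      positivity
    · rw [abs_of_pos h] at hx
      exact hQp x i h hx
  set q := Qlog x₀ with hqdef
  have hx₀i : ∀ i, |x₀ i| < χ₀ / θcl i := by
    intro i
    have h1 := wnorm_ge ⊤ le_top θcl x₀ i
    rw [abs_mul, abs_of_pos (hθcl i)] at h1
    have h2 := (hclEquiv x₀).1
    rw [lt_div_iff₀ (hθcl i)]
    have h3 : Lcl1 * wnorm ⊤ θcl x₀ < Lcl1 * (R / Lcl2) := by
      refine h2.trans_lt (hx₀.trans_eq ?_)
      rw [hLcl]; field_simp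
    have h4 := lt_of_mul_lt_mul_left h3 hLcl1.le
    linarith [hχ₀.1]
  have hwq : wnorm ⊤ θcl q ≤ (1 + ρ) / 2 * χ₀ := by
    refine wnorm_top_le _ _ _ (by positivity) fun i => ?_
    have h1 := hQall x₀ i (hx₀i i)
    have h2 := hθcl i
    rw [abs_mul, abs_of_pos h2]
    calc θcl i * |q i| ≤ θcl i * ((1 + ρ) / 2 * (χ₀ / θcl i)) :=
          mul_le_mul_of_nonneg_left h1 h2.le
      _ = _ := by field_simp
  have hlam0 : 0 < lam := lt_trans (by positivity) hlam.1
  have hNclq : Ncl q < lam * R := by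
    have h1 := (hclEquiv q).2.trans (mul_le_mul_of_nonneg_left hwq hLcl2.le)
    have h2 := hlam.1
    rw [div_lt_iff₀ (by positivity)] at h2
    nlinarith
  have hNq : Nop q < lam * R₂ := by
    have h1 := hΓle q
    have h2 := mul_lt_mul_of_pos_left hNclq hΓ
    have h3 := mul_le_mul_of_nonneg_left hΓR hlam0.le
    linarith
  have hqball : q ∈ nball Nop R₂ := by
    show Nop q < R₂
    nlinarith [hlam.2]
  have hNq0 := vn_nonneg hNop q
  have hν : 0 < 1 + nu d₁ d₂ τtmin := by
    by_contra! hc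
    nlinarith [hτtmin.2, mul_nonneg hlam0.le (neg_nonneg.2 hc)]
  have hT : Nop q * (1 + nu d₁ d₂ τtmin) < R₂ := by
    have := mul_lt_mul_of_pos_right hNq hν
    have h2 : lam * R₂ * (1 + nu d₁ d₂ τtmin) = R₂ := by
      rw [mul_right_comm, hτtmin.2, one_mul]
    linarith
  obtain ⟨hXc, hX0, hXd⟩ := hX q
  have hgrow := growth hn hNop hK (fun x => f x (g q)) R₂ d₁ d₂ hd₁ hd₂ (hC1 q hqball)
    (hmuop q hqball) q hqball (hfqq q hqball) (X q) hXc hX0 hXd τtmin hT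
  have hnumono : ∀ s t, s ≤ t → nu d₁ d₂ s ≤ nu d₁ d₂ t := fun s t hst =>
    mul_le_mul_of_nonneg_left (E_mono d₁ hst) hd₂.le
  have hin : ∀ s, 0 < s → s ≤ τtmin → Nop (X q s) < R₂ := by
    intro s hs hsT
    have h1 := hgrow s ⟨hs.le, hsT⟩
    have h2 := hNop.add_le q (X q s - q)
    rw [add_sub_cancel] at h2
    have h3 := mul_le_mul_of_nonneg_right (hnumono s τtmin hsT) hNq0
    linarith
  have hLop0 : 0 < Lop := by rw [hLop]; positivity
  have hpsi : ∀ s, 0 < s → s ≤ τtmin → s ≤ τmin → psiLog Nop d₁ Lop ρ X s q ≤ σ * Ncl q := by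
    intro s hs hsT hsm
    have h1 := hgrow s ⟨hs.le, hsT⟩
    have hk : 0 ≤ Lop * (1 - ρ) / (1 + ρ) :=
      div_nonneg (mul_nonneg hLop0.le (by linarith)) (by linarith)
    have h2 : Lop * (1 - ρ) / (1 + ρ) * Real.exp (d₁ * s) + nu d₁ d₂ s ≤ σ / Γ := by
      rw [← hτmin.2]
      have : Real.exp (d₁ * s) ≤ Real.exp (d₁ * τmin) := by gcongr
      exact add_le_add (mul_le_mul_of_nonneg_left this hk) (hnumono _ _ hsm)
    have h3 := mul_le_mul_of_nonneg_right h2 hNq0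
    have h4 : σ / Γ * Nop q ≤ σ * Ncl q := by
      rw [div_mul_eq_mul_div, div_le_iff₀ hΓ]
      nlinarith [mul_le_mul_of_nonneg_left (hΓle q) hσpos.le]
    unfold psiLog
    linarith
  have htilde : min τmax τtmin ≤ tauTilde Nop R₂ τmax X q := by
    unfold tauTilde
    split_ifs with hcs
    · exact min_le_left _ _
    · push Not at hcs
      obtain ⟨s, hs, hsR⟩ := hcs
      refine (min_le_right _ _).trans (le_csInf ⟨s, hs.1, hsR⟩ ?_)
      rintro t ⟨ht, htR⟩
      by_contra! hc
      exact absurd (hin t ht hc.le) (not_lt.2 htR)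
  unfold tauSamp
  split_ifs with hcs
  · refine le_trans ?_ htilde
    exact le_min (min_le_left _ _) ((min_le_right _ _).trans (min_le_right _ _))
  · push Not at hcs
    obtain ⟨s, hs, hsR⟩ := hcs
    refine (min_le_right _ _).trans (le_csInf ⟨s, hs.1, hsR⟩ ?_)
    rintro t ⟨ht, htR⟩
    by_contra! hc
    exact absurd (hpsi t ht (hc.le.trans (min_le_right _ _)) (hc.le.trans (min_le_left _ _)))
      (not_le.2 htR)

end
end

section
/- Suppose Assumptions 1, 2, 3, and 4 hold, and assume the quantization density ρ ∈ (0,1) and the threshold parameter σ ∈ (0, σ₀] satisfy Γ L_op(1−ρ)/(1+ρ) < σ < 2cρ/(αL_cl(1+ρ)) =: σ₁. Then the ODE ẋ(t) = f(x(t), g(q₀)) with x(0) = x₀ ∈ B_cl(R/L_cl) and q₀ := Q_log(x₀) has a unique solution x on [0, t₁], where t₁ > 0 is the first sampling time determined by the self-triggering mechanism, and this solution satisfies ‖x(t)‖_cl ≤ e^{−γt}‖x₀‖_cl for all t ∈ [0, t₁], where γ := −(1/τ_max)·log(e^{−cτ_max}(1 − σ/σ₁) + σ/σ₁). -/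
set_option autoImplicit false

open Filter Set MeasureTheory Real
open scoped Topology ENNReal

noncomputable section

namespace IsVecNorm

variable {n : ℕ} {N : (Fin n → ℝ) → ℝ}

lemma zero (h : IsVecNorm N) : N 0 = 0 := (h.eq_zero 0).2 rfl

lemma neg (h : IsVecNorm N) (x : Fin n → ℝ) : N (-x) = N x := by
  have := h.smul_eq (-1) x
  simpa using this

lemma nonneg (h : IsVecNorm N) (x : Fin n → ℝ) : 0 ≤ N x := by
  have h1 := h.add_le x (-x)
  rw [h.neg, add_neg_cancel, h.zero] at h1
  linarith

lemma pos (h : IsVecNorm N) {x : Fin n → ℝ} (hx : x ≠ 0) : 0 < N x :=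
  lt_of_le_of_ne (h.nonneg x) fun h0 => hx ((h.eq_zero x).1 h0.symm)

lemma sub_rev (h : IsVecNorm N) (x y : Fin n → ℝ) : N (x - y) = N (y - x) := by
  rw [← h.neg, neg_sub]

lemma smul_nonneg (h : IsVecNorm N) {a : ℝ} (ha : 0 ≤ a) (x : Fin n → ℝ) :
    N (a • x) = a * N x := by
  rw [h.smul_eq, abs_of_nonneg ha]

lemma convexOn (h : IsVecNorm N) : ConvexOn ℝ univ N := by
  refine ⟨convex_univ, fun x _ y _ a b ha hb _ => ?_⟩
  refine (h.add_le _ _).trans ?_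
  rw [h.smul_nonneg ha, h.smul_nonneg hb]
  rfl

lemma continuous (h : IsVecNorm N) : Continuous N :=
  h.convexOn.locallyLipschitz.continuous

lemma exists_lower (h : IsVecNorm N) : ∃ C : ℝ, 0 < C ∧ ∀ x, ‖x‖ ≤ C * N x := by
  rcases (Metric.sphere (0 : Fin n → ℝ) 1).eq_empty_or_nonempty with he | hne
  · refine ⟨1, one_pos, fun x => ?_⟩
    have hx : x = 0 := by
      by_contra hx
      have : ‖x‖⁻¹ • x ∈ Metric.sphere (0 : Fin n → ℝ) 1 := by
        simp [norm_smul, norm_ne_zero_iff.2 hx]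
      rw [he] at this
      exact this
    simp [hx, h.zero]
  · obtain ⟨z, hz, hmin⟩ := (isCompact_sphere (0 : Fin n → ℝ) 1).exists_isMinOn hne
      h.continuous.continuousOn
    have hz0 : z ≠ 0 := by
      rintro rfl
      simp at hz
    have hzp := h.pos hz0
    refine ⟨(N z)⁻¹, inv_pos.2 hzp, fun x => ?_⟩
    rcases eq_or_ne x 0 with rfl | hx
    · simp [h.zero]
    have hxn : 0 < ‖x‖ := norm_pos_iff.2 hx
    have hm : N z ≤ N (‖x‖⁻¹ • x) := hmin (by simp [norm_smul, hxn.ne'])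
    rw [h.smul_nonneg (by positivity)] at hm
    rw [inv_mul_eq_div, le_div_iff₀ hzp]
    calc ‖x‖ * N z ≤ ‖x‖ * (‖x‖⁻¹ * N x) := by gcongr
      _ = N x := by field_simp

lemma isOpen_nball (h : IsVecNorm N) (r : ℝ) : IsOpen (nball N r) :=
  isOpen_lt h.continuous continuous_const

lemma convex_nball (h : IsVecNorm N) (r : ℝ) : Convex ℝ (nball N r) := by
  have := h.convexOn.convex_lt r
  simpa [nball] using this

lemma isCompact_le (h : IsVecNorm N) (r : ℝ) : IsCompact {x | N x ≤ r} := by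
  obtain ⟨C, hC, hb⟩ := h.exists_lower
  refine (isCompact_closedBall (0 : Fin n → ℝ) (C * r)).of_isClosed_subset
    (isClosed_le h.continuous continuous_const) fun x hx => ?_
  rw [mem_closedBall_zero_iff]
  exact (hb x).trans (by have : N x ≤ r := hx; gcongr)

lemma convex_le (h : IsVecNorm N) (r : ℝ) : Convex ℝ {x | N x ≤ r} := by
  have := h.convexOn.convex_le r
  simpa using this

/-- supporting functional -/
lemma exists_support (h : IsVecNorm N) (v : Fin n → ℝ) :
    ∃ l : (Fin n → ℝ) →ₗ[ℝ] ℝ, (∀ x, l x ≤ N x) ∧ l v = N v := by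
  rcases eq_or_ne v 0 with rfl | hv
  · exact ⟨0, fun x => by simpa using h.nonneg x, by simp [h.zero]⟩
  have H : ∀ c : ℝ, c • v = 0 → (RingHom.id ℝ c) • N v = 0 := fun c hc => by
    rw [(smul_eq_zero.1 hc).resolve_right hv, map_zero, zero_smul]
  obtain ⟨g, hg, hle⟩ := exists_extension_of_le_sublinear
    (LinearPMap.mkSpanSingleton' v (N v) H) N (fun a ha x => h.smul_nonneg ha.le x) h.add_le
    (by
      rintro ⟨x, hx⟩
      obtain ⟨a, rfl⟩ := Submodule.mem_span_singleton.1 hx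
      rw [LinearPMap.mkSpanSingleton'_apply, h.smul_eq, smul_eq_mul]
      exact mul_le_mul_of_nonneg_right (le_abs_self a) (h.nonneg v))
  refine ⟨g, hle, ?_⟩
  have h1 := hg ⟨v, Submodule.mem_span_singleton_self v⟩
  exact h1.trans (LinearPMap.mkSpanSingleton'_apply_self v (N v) H _)

lemma matSet_bdd (h : IsVecNorm N) (A : Matrix (Fin n) (Fin n) ℝ) :
    BddAbove {c : ℝ | ∃ x : Fin n → ℝ, N x = 1 ∧ c = N (A.mulVec x)} := by
  have hc : IsCompact ((fun x => N (A.mulVec x)) '' {x | N x ≤ 1}) :=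
    (h.isCompact_le 1).image (h.continuous.comp (by fun_prop))
  refine hc.bddAbove.mono ?_
  rintro c ⟨x, hx, rfl⟩
  exact ⟨x, hx.le, rfl⟩

lemma mulVec_le (h : IsVecNorm N) (A : Matrix (Fin n) (Fin n) ℝ) (x : Fin n → ℝ) :
    N (A.mulVec x) ≤ matNorm N A * N x := by
  rcases eq_or_ne x 0 with rfl | hx
  · simp [h.zero]
  have hp := h.pos hx
  have h1 : N (A.mulVec ((N x)⁻¹ • x)) ≤ matNorm N A :=
    le_csSup (h.matSet_bdd A) ⟨_, by
      rw [h.smul_nonneg (by positivity)]; field_simp, rfl⟩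
  rw [Matrix.mulVec_smul, h.smul_nonneg (by positivity), inv_mul_le_iff₀ hp] at h1
  linarith

lemma matNorm_le (h : IsVecNorm N) (A : Matrix (Fin n) (Fin n) ℝ) {v : Fin n → ℝ} (hv : v ≠ 0)
    {C : ℝ} (hC : ∀ x, N x = 1 → N (A.mulVec x) ≤ C) : matNorm N A ≤ C := by
  apply csSup_le
  · refine ⟨_, (N v)⁻¹ • v, ?_, rfl⟩
    have hp := h.pos hv
    rw [h.smul_nonneg (by positivity)]; field_simp
  · rintro c ⟨x, hx, rfl⟩
    exact hC x hx

/-- the log norm controls supporting functionals -/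
lemma support_le_logNorm (h : IsVecNorm N) (A : Matrix (Fin n) (Fin n) ℝ) (v : Fin n → ℝ)
    (l : (Fin n → ℝ) →ₗ[ℝ] ℝ) (hl : ∀ x, l x ≤ N x) (hlv : l v = N v) :
    l (A.mulVec v) ≤ logNorm N A * N v := by
  rcases eq_or_ne v 0 with rfl | hv
  · simp [h.zero]
  have hp := h.pos hv
  set φ : ℝ → ℝ := fun ε : ℝ => (matNorm N (1 + ε • A) - 1) / ε with hφ
  have hlow : ∀ ε ∈ Ioi (0:ℝ), l (A.mulVec v) / N v ≤ φ ε := by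
    intro ε hε
    have hε : 0 < ε := hε
    rw [hφ]
    simp only
    rw [div_le_div_iff₀ hp hε]
    have h1 := h.mulVec_le (1 + ε • A) v
    have h2 := hl ((1 + ε • A).mulVec v)
    rw [Matrix.add_mulVec, Matrix.one_mulVec, Matrix.smul_mulVec] at h1 h2
    rw [map_add, map_smul, hlv, smul_eq_mul] at h2
    linarith
  have hmono : MonotoneOn φ (Ioi 0) := by
    intro a ha b hb hab
    have ha : 0 < a := ha
    have hb : 0 < b := hb
    have hkey : matNorm N (1 + a • A) ≤ (1 - a / b) + (a / b) * matNorm N (1 + b • A) := by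
      refine h.matNorm_le _ hv fun x hx => ?_
      have hab' : a / b ≤ 1 := (div_le_one hb).2 hab
      have e : (1 + a • A).mulVec x = (1 - a / b) • x + (a / b) • (1 + b • A).mulVec x := by
        simp only [Matrix.add_mulVec, Matrix.one_mulVec, Matrix.smul_mulVec, smul_add, smul_smul]
        rw [div_mul_cancel₀ _ hb.ne']
        module
      rw [e]
      refine (h.add_le _ _).trans ?_
      rw [h.smul_nonneg (by linarith), h.smul_nonneg (by positivity), hx, mul_one]
      have := h.mulVec_le (1 + b • A) x
      rw [hx, mul_one] at this
      gcongr
    simp only [hφ]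
    rw [div_le_div_iff₀ ha hb]
    have := mul_le_mul_of_nonneg_right hkey hb.le
    have e2 : ((1 - a / b) + (a / b) * matNorm N (1 + b • A)) * b
      = b - a + a * matNorm N (1 + b • A) := by field_simp
    rw [e2] at this
    linarith
  have hbdd : BddBelow (φ '' Ioi 0) := ⟨_, by rintro _ ⟨ε, hε, rfl⟩; exact hlow ε hε⟩
  have ht := MonotoneOn.tendsto_nhdsGT hmono hbdd
  have hlim : logNorm N A = sInf (φ '' Ioi 0) := ht.limUnder_eq
  rw [hlim, ← div_le_iff₀ hp]
  refine le_csInf ⟨_, 1, by simp, rfl⟩ ?_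
  rintro _ ⟨ε, hε, rfl⟩; exact hlow ε hε

end IsVecNorm

lemma ae_line {n : ℕ} {P : (Fin n → ℝ) → Prop} (hP : ∀ᵐ z ∂(volume : Measure (Fin n → ℝ)), P z)
    (v : Fin n → ℝ) :
    ∀ᵐ y ∂(volume : Measure (Fin n → ℝ)), ∀ᵐ s ∂(volume : Measure ℝ), P (y + s • v) := by
  obtain ⟨t, hst, mt, ht⟩ := exists_measurable_superset_of_null (show volume {z | ¬ P z} = 0 from hP)
  have key : ∀ᵐ y ∂(volume : Measure (Fin n → ℝ)), ∀ᵐ s ∂(volume : Measure ℝ), y + s • v ∉ t := by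
    rw [Measure.ae_ae_comm]
    · refine Eventually.of_forall fun s => ?_
      have h1 : volume ((fun y : Fin n → ℝ => y + s • v) ⁻¹' t) = 0 := by
        rw [measure_preimage_add_right, ht]
      rw [ae_iff]
      simp only [not_not]
      exact h1
    · have hm : Measurable (fun p : (Fin n → ℝ) × ℝ => p.1 + p.2 • v) := by fun_prop
      exact hm mt.compl
  filter_upwards [key] with y hy
  filter_upwards [hy] with s hs
  by_contra hc
  exact hs (hst hc)

lemma osl {n : ℕ} {N : (Fin n → ℝ) → ℝ} (h : IsVecNorm N) {F : (Fin n → ℝ) → (Fin n → ℝ)}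
    {U : Set (Fin n → ℝ)} (hU : IsOpen U) (hUc : Convex ℝ U) (hLip : LocallyLipschitzOn U F)
    {k : ℝ} (hae : ∀ᵐ z ∂(volume : Measure (Fin n → ℝ)), z ∈ U →
      DifferentiableAt ℝ F z ∧ logNorm N (jacobian F z) ≤ k)
    {x y : Fin n → ℝ} (hx : x ∈ U) (hy : y ∈ U) (l : (Fin n → ℝ) →ₗ[ℝ] ℝ)
    (hl : ∀ z, l z ≤ N z) (hlv : l (x - y) = N (x - y)) :
    l (F x - F y) ≤ k * N (x - y) := by
  set v := x - y with hv
  set L : (Fin n → ℝ) →L[ℝ] ℝ := LinearMap.toContinuousLinearMap l with hL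
  have hLl : ∀ z, L z = l z := fun z => rfl
  have hD := ae_line hae v
  set D := {y' : Fin n → ℝ | ∀ᵐ s ∂(volume : Measure ℝ), y' + s • v ∈ U →
      DifferentiableAt ℝ F (y' + s • v) ∧ logNorm N (jacobian F (y' + s • v)) ≤ k} with hDdef
  have hDd : Dense D := Measure.dense_of_ae hD
  set W := {y' : Fin n → ℝ | y' ∈ U ∧ y' + v ∈ U} with hW
  have hWo : IsOpen W := hU.inter (hU.preimage (by fun_prop : Continuous fun y' => y' + v))
  have hxv : y + v = x := by rw [hv]; abel
  have hyW : y ∈ W := ⟨hy, by rw [hxv]; exact hx⟩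
  have hcl : y ∈ closure (W ∩ D) := by
    have := hDd.open_subset_closure_inter hWo
    exact this hyW
  have hmain : ∀ y' ∈ W ∩ D, L (F (y' + v) - F y') ≤ k * N v := by
    rintro y' ⟨⟨hy'1, hy'2⟩, hy'D⟩
    have hseg : ∀ s ∈ Icc (0:ℝ) 1, y' + s • v ∈ U := by
      intro s hs
      have := hUc hy'1 hy'2 (sub_nonneg.2 hs.2) hs.1 (by ring)
      convert this using 1
      module
    set p : ℝ → (Fin n → ℝ) := fun s => y' + s • v with hp
    have hpc : Continuous p := by fun_prop
    have hpL : LipschitzWith ‖v‖₊ p := by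
      refine LipschitzWith.of_dist_le_mul fun a b => ?_
      rw [hp]
      simp only [dist_add_left]
      rw [dist_eq_norm, ← sub_smul, norm_smul, Real.dist_eq, Real.norm_eq_abs, mul_comm]
      rfl
    obtain ⟨K, hK⟩ := (hLip.mono (image_subset_iff.2 hseg)).exists_lipschitzOnWith_of_compact
      (isCompact_Icc.image hpc)
    have hφL : LipschitzOnWith (‖L‖₊ * (K * ‖v‖₊)) (fun s => L (F (p s))) (uIcc 0 1) := by
      rw [uIcc_of_le zero_le_one]
      exact (L.lipschitz.lipschitzOnWith (s := univ)).comp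
        (hK.comp (hpL.lipschitzOnWith (s := Icc 0 1)) (mapsTo_image _ _)) (mapsTo_univ _ _)
    have hac := hφL.absolutelyContinuousOnInterval
    have hint := hac.integral_deriv_eq_sub
    have hle : ∫ s in (0:ℝ)..1, deriv (fun s => L (F (p s))) s ≤ ∫ s in (0:ℝ)..1, k * N v := by
      refine intervalIntegral.integral_mono_ae_restrict zero_le_one hac.intervalIntegrable_deriv
        intervalIntegrable_const ?_
      refine (ae_restrict_iff' measurableSet_Icc).2 ?_
      have hy'D' : ∀ᵐ s ∂(volume : Measure ℝ), y' + s • v ∈ U →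
        DifferentiableAt ℝ F (y' + s • v) ∧ logNorm N (jacobian F (y' + s • v)) ≤ k := hy'D
      filter_upwards [hy'D'] with s hs hs01
      obtain ⟨hd, hlog⟩ := hs (hseg s hs01)
      have hpd : HasDerivAt p v s := by
        have := ((hasDerivAt_id s).smul_const v).const_add y'
        rw [one_smul] at this
        exact this
      have hder : HasDerivAt (fun s => L (F (p s))) (L (fderiv ℝ F (p s) v)) s :=
        L.hasFDerivAt.comp_hasDerivAt s ((hd.hasFDerivAt (x := p s)).comp_hasDerivAt s hpd)
      rw [hder.deriv, ← jacobian_mulVec]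
      refine (h.support_le_logNorm _ v l hl hlv).trans ?_
      exact mul_le_mul_of_nonneg_right hlog (h.nonneg v)
    rw [hint] at hle
    simp only [hp, one_smul, zero_smul, add_zero] at hle
    rw [map_sub]
    simpa using hle
  have hcF : ∀ z ∈ U, ContinuousAt F z := fun z hz =>
    hLip.continuousOn.continuousAt (hU.mem_nhds hz)
  have hct : ContinuousAt (fun y' => L (F (y' + v) - F y')) y := by
    refine L.continuous.continuousAt.comp (ContinuousAt.sub ?_ (hcF y hy))
    refine ContinuousAt.comp (f := fun y' => y' + v) (g := F) ?_ (by fun_prop)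
    rw [hxv]
    exact hcF x hx
  have := mem_closure_iff_nhdsWithin_neBot.1 hcl
  have hfin := le_of_tendsto (hct.tendsto.mono_left (nhdsWithin_le_nhds (s := W ∩ D)))
    (eventually_nhdsWithin_of_forall hmain)
  rw [hxv] at hfin
  exact hfin

lemma norm_gronwall {n : ℕ} {N : (Fin n → ℝ) → ℝ} (h : IsVecNorm N) {v v' : ℝ → (Fin n → ℝ)}
    {b K ε : ℝ} (hv : ContinuousOn v (Icc 0 b)) (hv' : ContinuousOn v' (Icc 0 b))
    (hd : ∀ t ∈ Ico 0 b, HasDerivWithinAt v (v' t) (Ici t) t)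
    (hb : ∀ t ∈ Ico 0 b, ∀ l : (Fin n → ℝ) →ₗ[ℝ] ℝ, (∀ z, l z ≤ N z) → l (v t) = N (v t) →
      l (v' t) ≤ K * N (v t) + ε) :
    ∀ t ∈ Icc 0 b, N (v t) ≤ gronwallBound (N (v 0)) K ε t := by
  have hNv : ContinuousOn (fun t => N (v t)) (Icc 0 b) := h.continuous.comp_continuousOn hv
  have := le_gronwallBound_of_liminf_deriv_right_le (f := fun t => N (v t))
    (f' := fun t => K * N (v t) + ε) (δ := N (v 0)) (K := K) (ε := ε) (a := 0) (b := b)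
    hNv ?_ le_rfl (fun _ _ => le_rfl)
  · intro t ht
    have h1 := this t ht
    rwa [sub_zero] at h1
  intro t ht r hr
  apply Eventually.frequently
  have hIoo : Ioo t b ∈ 𝓝[>] t := Ioo_mem_nhdsGT ht.2
  have hsub : Ioo t b ⊆ Icc 0 b := fun z hz => ⟨ht.1.trans hz.1.le, hz.2.le⟩
  have hle : 𝓝[>] t ≤ 𝓝[Icc 0 b] t := by
    rw [← nhdsWithin_Ioo_eq_nhdsGT ht.2]
    exact nhdsWithin_mono _ hsub
  have htI : t ∈ Icc 0 b := ⟨ht.1, ht.2.le⟩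
  have t1 : Tendsto (fun z => N (v z)) (𝓝[>] t) (𝓝 (N (v t))) := (hNv t htI).mono_left hle
  have t2 : Tendsto (fun z => N (v' t - v' z)) (𝓝[>] t) (𝓝 0) := by
    have : Tendsto (fun z => v' t - v' z) (𝓝[>] t) (𝓝 (v' t - v' t)) :=
      tendsto_const_nhds.sub ((hv' t htI).mono_left hle)
    rw [sub_self] at this
    have h2 := (h.continuous.tendsto 0).comp this
    rwa [h.zero] at h2
  have t3 : Tendsto (fun z => N ((z - t)⁻¹ • (v z - v t) - v' t)) (𝓝[>] t) (𝓝 0) := by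
    have h0 := (hasDerivWithinAt_iff_tendsto_slope.1 (hd t ht))
    rw [Ici_sdiff_left] at h0
    have : Tendsto (fun z => (z - t)⁻¹ • (v z - v t) - v' t) (𝓝[>] t) (𝓝 (v' t - v' t)) :=
      h0.sub_const _
    rw [sub_self] at this
    have h2 := (h.continuous.tendsto 0).comp this
    rwa [h.zero] at h2
  have tt := ((t1.const_mul K).add_const ε).add (t2.add t3)
  rw [add_zero, add_zero] at tt
  filter_upwards [tt.eventually_lt_const hr, hIoo] with z hz hzI
  refine lt_of_le_of_lt ?_ hz
  obtain ⟨l, hl, hlv⟩ := h.exists_support (v z)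
  have hzt : 0 < z - t := sub_pos.2 hzI.1
  have e1 := hb z ⟨ht.1.trans hzI.1.le, hzI.2⟩ l hl hlv
  have e2 := hl (v' t - v' z)
  have e3 := hl ((z - t)⁻¹ • (v z - v t) - v' t)
  have e4 := hl (v t)
  rw [map_sub] at e2
  rw [map_sub, map_smul, map_sub, hlv, smul_eq_mul] at e3
  have e5 : (z - t)⁻¹ * (N (v z) - N (v t)) ≤ (z - t)⁻¹ * (N (v z) - l (v t)) := by gcongr
  linarith

lemma cl_bound_le {c τ κ t : ℝ} (hτ : 0 < τ) (hκ0 : 0 < κ) (hκ1 : κ < 1) (ht : t ∈ Icc 0 τ) :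
    Real.exp (-c * t) * (1 - κ) + κ ≤
      Real.exp (-(-(1 / τ) * Real.log (Real.exp (-c * τ) * (1 - κ) + κ)) * t) := by
  set s := t / τ with hs
  have hs0 : 0 ≤ s := div_nonneg ht.1 hτ.le
  have hs1 : s ≤ 1 := (div_le_one hτ).2 ht.2
  have hpos : 0 < Real.exp (-c * τ) * (1 - κ) + κ := by
    have := Real.exp_pos (-c * τ)
    have : 0 < 1 - κ := by linarith
    positivity
  have hJ := (Real.concaveOn_rpow hs0 hs1).2 (Real.exp_pos (-c * τ)).le
    (zero_le_one (α := ℝ)) (show (0:ℝ) ≤ 1 - κ by linarith) hκ0.le (by ring)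
  simp only [smul_eq_mul, Real.one_rpow, mul_one] at hJ
  rw [← Real.exp_mul] at hJ
  have e1 : -c * τ * s = -c * t := by rw [hs]; field_simp
  rw [e1] at hJ
  rw [Real.rpow_def_of_pos (by linarith)] at hJ
  have e2 : -(-(1 / τ) * Real.log (Real.exp (-c * τ) * (1 - κ) + κ)) * t
      = Real.log ((1 - κ) * Real.exp (-c * τ) + κ) * s := by
    rw [hs, mul_comm (1 - κ)]; field_simp
  rw [e2]
  linarith

lemma wnorm_mono {n : ℕ} {r : ℝ≥0∞} (hr : 1 ≤ r) (θ : Fin n → ℝ) {x y : Fin n → ℝ} {k : ℝ}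
    (hk : 0 ≤ k) (hxy : ∀ i, |x i| ≤ k * |y i|) : wnorm r θ x ≤ k * wnorm r θ y := by
  have : Fact (1 ≤ r) := ⟨hr⟩
  have e : k * wnorm r θ y =
      ‖(WithLp.equiv r (∀ _ : Fin n, ℝ)).symm (fun i => θ i * (k * y i))‖ := by
    unfold wnorm
    have : (WithLp.equiv r (∀ _ : Fin n, ℝ)).symm (fun i => θ i * (k * y i))
      = k • (WithLp.equiv r (∀ _ : Fin n, ℝ)).symm (fun i => θ i * y i) := by
      ext i
      simp
      ring
    rw [this, norm_smul, Real.norm_of_nonneg hk]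
  rw [e]
  unfold wnorm
  have hcomp : ∀ i, |θ i * x i| ≤ |θ i * (k * y i)| := by
    intro i
    rw [abs_mul, abs_mul, abs_mul k, abs_of_nonneg hk]
    exact mul_le_mul_of_nonneg_left (hxy i) (abs_nonneg _)
  rcases eq_or_ne r ⊤ with rfl | hrt
  · simp only [WithLp.equiv_symm_apply, PiLp.norm_toLp]
    exact (pi_norm_le_iff_of_nonneg (norm_nonneg _)).2 fun i =>
      (hcomp i).trans (norm_le_pi_norm (fun i => θ i * (k * y i)) i)
  · have hr0 : 0 < r.toReal := ENNReal.toReal_pos (by positivity) hrt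
    rw [PiLp.norm_eq_sum hr0, PiLp.norm_eq_sum hr0]
    gcongr with i
    exact hcomp i

lemma wnorm_top {n : ℕ} (θ x : Fin n → ℝ) : wnorm ⊤ θ x = ‖fun i => θ i * x i‖ := by
  unfold wnorm
  simp only [WithLp.equiv_symm_apply, PiLp.norm_toLp]

lemma quant_pos {ρ a z : ℝ} (hρ : 0 < ρ ∧ ρ < 1) (ha : 0 < a) (hz : 0 < z) (hza : z < a)
    {q : ℝ} (hQ : ∀ j : ℤ, ρ ^ (j + 1) * a ≤ z → z < ρ ^ j * a →
      q = (ρ ^ j * a + ρ ^ (j + 1) * a) / 2) :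
    |q - z| ≤ (1 - ρ) / (1 + ρ) * |q| ∧ |q| ≤ (1 + ρ) / (2 * ρ) * |z| ∧ |q| ≤ (1 + ρ) / 2 * a := by
  obtain ⟨hρ0, hρ1⟩ := hρ
  obtain ⟨k, hk1, hk2⟩ := exists_mem_Ico_zpow (div_pos hz ha) ((one_lt_inv₀ hρ0).2 hρ1)
  rw [inv_zpow', le_div_iff₀ ha] at hk1
  rw [inv_zpow', div_lt_iff₀ ha] at hk2
  have ej : -(k + 1) + 1 = -k := by ring
  have hq := hQ (-(k + 1)) (by rw [ej]; exact hk1) hk2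
  set j := -(k + 1) with hj
  rw [← ej] at hk1
  have hpow : ρ ^ (j + 1) = ρ ^ j * ρ := zpow_add_one₀ hρ0.ne' j
  have hj0 : 0 ≤ j := by
    by_contra hneg
    have h1 : (1:ℝ) ≤ ρ ^ (j + 1) := one_le_zpow_of_nonpos₀ hρ0 hρ1.le (by omega)
    nlinarith
  have hj1 : ρ ^ j ≤ 1 := zpow_le_one₀ hρ0 hρ1.le hj0
  have hjp : 0 < ρ ^ j := zpow_pos hρ0 j
  rw [hpow] at hk1 hq
  set u := ρ ^ j * a with hu
  have hup : 0 < u := by positivity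
  have hua : u ≤ a := by rw [hu]; nlinarith
  have hk1' : u * ρ ≤ z := by rw [hu]; linarith
  have hq' : q = (1 + ρ) / 2 * u := by rw [hq]; ring
  have hqp : 0 < q := by rw [hq']; positivity
  rw [abs_of_pos hqp, abs_of_pos hz]
  refine ⟨?_, ?_, ?_⟩
  · have : (1 - ρ) / (1 + ρ) * q = (1 - ρ) / 2 * u := by rw [hq']; field_simp
    rw [this, abs_le, hq']
    constructor <;> linarith
  · rw [hq']
    have : (1 + ρ) / 2 * u = (1 + ρ) / (2 * ρ) * (u * ρ) := by field_simp
    rw [this]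
    gcongr
  · rw [hq']
    gcongr

lemma quant {n : ℕ} {θcl : Fin n → ℝ} (hθcl : ∀ i, 0 < θcl i)
    {ρ : ℝ} (hρ : 0 < ρ ∧ ρ < 1) {χ₀ : ℝ} (hχ₀pos : 0 < χ₀)
    (Qlog : (Fin n → ℝ) → (Fin n → ℝ))
    (hQ0 : ∀ (x : Fin n → ℝ) (i : Fin n), x i = 0 → Qlog x i = 0)
    (hQpos : ∀ (x : Fin n → ℝ) (i : Fin n) (j : ℤ),
      ρ ^ (j + 1) * (χ₀ / θcl i) ≤ x i → x i < ρ ^ j * (χ₀ / θcl i) →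
      Qlog x i = (ρ ^ j * (χ₀ / θcl i) + ρ ^ (j + 1) * (χ₀ / θcl i)) / 2)
    (hQneg : ∀ (x : Fin n → ℝ) (i : Fin n), x i < 0 → Qlog x i = - Qlog (-x) i)
    (x : Fin n → ℝ) (i : Fin n) (hx : |x i| < χ₀ / θcl i) :
    |Qlog x i - x i| ≤ (1 - ρ) / (1 + ρ) * |Qlog x i| ∧
      |Qlog x i| ≤ (1 + ρ) / (2 * ρ) * |x i| ∧ |Qlog x i| ≤ (1 + ρ) / 2 * (χ₀ / θcl i) := by
  have ha : 0 < χ₀ / θcl i := div_pos hχ₀pos (hθcl i)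
  rcases lt_trichotomy (x i) 0 with h | h | h
  · have hn : 0 < (-x) i := by simpa using h
    have h2 : (-x) i < χ₀ / θcl i := by
      rw [abs_of_neg h] at hx; simpa using hx
    have := quant_pos hρ ha hn h2 (fun j => hQpos (-x) i j)
    rw [hQneg x i h, abs_neg]
    have e : -Qlog (-x) i - x i = -(Qlog (-x) i - (-x) i) := by simp; ring
    rw [e, abs_neg]
    have e2 : |(-x) i| = |x i| := by simp
    rwa [e2] at this
  · rw [hQ0 x i h, h]
    have : 0 < (1 + ρ) / 2 := by linarith [hρ.1]
    simp only [sub_self, abs_zero, mul_zero, le_refl, true_and]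
    positivity
  · have h2 : x i < χ₀ / θcl i := by rwa [abs_of_pos h] at hx
    exact quant_pos hρ ha h h2 (fun j => hQpos x i j)

lemma timing {n : ℕ} {Ncl Nop : (Fin n → ℝ) → ℝ} (hNop : IsVecNorm Nop) {R₂ τmax σ d₁ Lop ρ : ℝ}
    {X : (Fin n → ℝ) → ℝ → (Fin n → ℝ)} {q : Fin n → ℝ} (hXc : Continuous (X q))
    (hX0 : X q 0 = q) (hq : Nop q < R₂) (hτ : 0 < τmax) {δ : ℝ} (hδ : 0 < δ)
    (hpsi : ∀ s ∈ Ico 0 δ, psiLog Nop d₁ Lop ρ X s q ≤ σ * Ncl q) :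
    0 < tauSamp Ncl Nop R₂ τmax σ d₁ Lop ρ X q ∧ tauSamp Ncl Nop R₂ τmax σ d₁ Lop ρ X q ≤ τmax ∧
    ∀ s ∈ Ico 0 (tauSamp Ncl Nop R₂ τmax σ d₁ Lop ρ X q),
      Nop (X q s) < R₂ ∧ psiLog Nop d₁ Lop ρ X s q ≤ σ * Ncl q := by
  have hT : 0 < tauTilde Nop R₂ τmax X q ∧ tauTilde Nop R₂ τmax X q ≤ τmax ∧
      ∀ s ∈ Ico 0 (tauTilde Nop R₂ τmax X q), Nop (X q s) < R₂ := by
    have h0 : Nop (X q 0) < R₂ := by rwa [hX0]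
    unfold tauTilde
    split_ifs with hc
    · refine ⟨hτ, le_rfl, fun s hs => ?_⟩
      rcases hs.1.eq_or_lt with rfl | h
      · exact h0
      · exact hc s ⟨h, hs.2⟩
    · push Not at hc
      obtain ⟨s₀, hs₀, hs₀R⟩ := hc
      have hbdd : BddBelow {s : ℝ | 0 < s ∧ R₂ ≤ Nop (X q s)} := ⟨0, fun s hs => hs.1.le⟩
      have hev : ∀ᶠ s in 𝓝 (0:ℝ), Nop (X q s) < R₂ :=
        (hNop.continuous.comp hXc).continuousAt.eventually_lt_const h0
      obtain ⟨η, hη, hball⟩ := Metric.eventually_nhds_iff.1 hev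
      refine ⟨?_, (csInf_le hbdd ⟨hs₀.1, hs₀R⟩).trans hs₀.2.le, ?_⟩
      · refine lt_of_lt_of_le hη (le_csInf ⟨s₀, hs₀.1, hs₀R⟩ fun s hs => ?_)
        by_contra hlt
        push Not at hlt
        have := hball (y := s) (by rw [Real.dist_eq, sub_zero, abs_of_pos hs.1]; exact hlt)
        exact absurd hs.2 (not_le.2 this)
      · intro s hs
        rcases hs.1.eq_or_lt with rfl | h
        · exact h0
        · by_contra hge
          exact notMem_of_lt_csInf hs.2 hbdd ⟨h, not_lt.1 hge⟩
  obtain ⟨hT0, hT1, hT2⟩ := hT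
  unfold tauSamp
  split_ifs with hc
  · refine ⟨hT0, hT1, fun s hs => ⟨hT2 s hs, ?_⟩⟩
    rcases hs.1.eq_or_lt with rfl | h
    · exact hpsi 0 ⟨le_rfl, hδ⟩
    · exact hc s ⟨h, hs.2⟩
  · push Not at hc
    obtain ⟨s₀, hs₀, hs₀R⟩ := hc
    have hbdd : BddBelow {s : ℝ | 0 < s ∧ σ * Ncl q < psiLog Nop d₁ Lop ρ X s q} :=
      ⟨0, fun s hs => hs.1.le⟩
    have hle := csInf_le hbdd ⟨hs₀.1, hs₀R⟩
    refine ⟨?_, hle.trans (hs₀.2.le.trans hT1), ?_⟩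
    · refine lt_of_lt_of_le hδ (le_csInf ⟨s₀, hs₀.1, hs₀R⟩ fun s hs => ?_)
      by_contra hlt
      push Not at hlt
      exact absurd hs.2 (not_lt.2 (hpsi s ⟨hs.1.le, hlt⟩))
    · intro s hs
      refine ⟨hT2 s ⟨hs.1, hs.2.trans_le (hle.trans hs₀.2.le)⟩, ?_⟩
      rcases hs.1.eq_or_lt with rfl | h
      · exact hpsi 0 ⟨le_rfl, hδ⟩
      · by_contra hge
        exact notMem_of_lt_csInf hs.2 hbdd ⟨h, not_le.1 hge⟩

lemma op_estimate {n : ℕ} {N : (Fin n → ℝ) → ℝ} (h : IsVecNorm N) {G : (Fin n → ℝ) → (Fin n → ℝ)}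
    (hG : Continuous G) {U : Set (Fin n → ℝ)} {d : ℝ}
    (hosl : ∀ x ∈ U, ∀ y ∈ U, ∀ l : (Fin n → ℝ) →ₗ[ℝ] ℝ, (∀ z, l z ≤ N z) →
      l (x - y) = N (x - y) → l (G x - G y) ≤ d * N (x - y))
    {x y : ℝ → (Fin n → ℝ)} {b : ℝ} (hx : ContinuousOn x (Icc 0 b)) (hy : ContinuousOn y (Icc 0 b))
    (hxd : ∀ t ∈ Ico 0 b, HasDerivWithinAt x (G (x t)) (Ici t) t)
    (hyd : ∀ t ∈ Ico 0 b, HasDerivWithinAt y (G (y t)) (Ici t) t)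
    (hxU : ∀ t ∈ Ico 0 b, x t ∈ U) (hyU : ∀ t ∈ Ico 0 b, y t ∈ U) :
    ∀ t ∈ Icc 0 b, N (x t - y t) ≤ N (x 0 - y 0) * Real.exp (d * t) := by
  have := norm_gronwall h (v := fun t => x t - y t) (v' := fun t => G (x t) - G (y t)) (b := b)
    (K := d) (ε := 0) (hx.sub hy)
    ((hG.comp_continuousOn hx).sub (hG.comp_continuousOn hy))
    (fun t ht => (hxd t ht).sub (hyd t ht))
    (fun t ht l hl hlv => by
      rw [add_zero]
      exact hosl _ (hxU t ht) _ (hyU t ht) l hl hlv)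
  simpa only [gronwallBound_ε0] using this

lemma first_exit {u : ℝ → ℝ} {T R : ℝ} (hu : ContinuousOn u (Icc 0 T)) (h0 : u 0 < R)
    (hstep : ∀ b, 0 < b → b ≤ T → (∀ s ∈ Ico 0 b, u s < R) → u b < R) :
    ∀ s ∈ Icc 0 T, u s < R := by
  by_contra! hcon
  obtain ⟨s, hs, hsR⟩ := hcon
  have hcl : IsClosed (Icc 0 T ∩ u ⁻¹' Ici R) := hu.preimage_isClosed_of_isClosed isClosed_Icc isClosed_Ici
  have hcomp : IsCompact (Icc 0 T ∩ u ⁻¹' Ici R) :=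
    isCompact_Icc.of_isClosed_subset hcl inter_subset_left
  obtain ⟨b, ⟨hbI, hbR⟩, hbl⟩ := hcomp.exists_isLeast ⟨s, hs, hsR⟩
  have hbR : R ≤ u b := hbR
  have hb0 : 0 < b := by
    rcases hbI.1.eq_or_lt with h | h
    · rw [← h] at hbR; linarith
    · exact h
  have := hstep b hb0 hbI.2 fun s' hs' => by
    by_contra hge
    have := hbl ⟨⟨hs'.1, hs'.2.le.trans hbI.2⟩, not_lt.1 hge⟩
    exact absurd hs'.2 (not_lt.2 this)
  linarith

lemma exists_sol {n : ℕ} {G : (Fin n → ℝ) → (Fin n → ℝ)} {K : NNReal} (hG : LipschitzWith K G)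
    {M : NNReal} (hM : ∀ x, ‖G x‖ ≤ M) (x₀ : Fin n → ℝ) {T : ℝ} (hT : 0 ≤ T) :
    ∃ x : ℝ → (Fin n → ℝ), x 0 = x₀ ∧
      ∀ s ∈ Icc 0 T, HasDerivWithinAt x (G (x s)) (Icc 0 T) s := by
  have hP : IsPicardLindelof (fun _ : ℝ => G) (⟨0, le_rfl, hT⟩ : Icc 0 T) x₀
      (M * T.toNNReal) 0 M K := by
    refine IsPicardLindelof.of_time_independent (fun x _ => hM x) hG.lipschitzOnWith ?_
    simp [hT]
  exact hP.exists_eq_forall_mem_Icc_hasDerivWithinAt₀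

lemma exists_extension {n : ℕ} {G : (Fin n → ℝ) → (Fin n → ℝ)} {K : NNReal}
    {S : Set (Fin n → ℝ)} (hS : IsCompact S) (hG : LipschitzOnWith K G S) :
    ∃ (G' : (Fin n → ℝ) → (Fin n → ℝ)) (M : NNReal), LipschitzWith K G' ∧ EqOn G G' S ∧
      ∀ x, ‖G' x‖ ≤ M := by
  obtain ⟨H, hH, hHe⟩ := hG.extend_pi
  obtain ⟨C, hC⟩ := (hS.image_of_continuousOn hG.continuousOn).isBounded.exists_norm_le
  set M : NNReal := C.toNNReal with hM
  have hCM : ∀ x ∈ S, ‖G x‖ ≤ M := fun x hx =>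
    (hC _ (mem_image_of_mem _ hx)).trans (Real.le_coe_toNNReal C)
  refine ⟨fun x i => max (-(M:ℝ)) (min M (H x i)), M, ?_, ?_, ?_⟩
  · refine LipschitzWith.of_dist_le_mul fun x y => ?_
    refine (dist_pi_le_iff (by positivity)).2 fun i => ?_
    have h1 : LipschitzWith K (fun x => H x i) :=
      LipschitzWith.of_dist_le_mul fun a b =>
        (dist_le_pi_dist (H a) (H b) i).trans (hH.dist_le_mul a b)
    exact ((h1.const_min _).const_max _).dist_le_mul x y
  · intro x hx
    ext i
    have h1 : |G x i| ≤ M := (norm_le_pi_norm (G x) i).trans (hCM x hx)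
    rw [abs_le] at h1
    rw [hHe hx] at h1 ⊢
    simp only
    rw [min_eq_right h1.2, max_eq_right h1.1]
  · intro x
    refine (pi_norm_le_iff_of_nonneg M.2).2 fun i => ?_
    rw [Real.norm_eq_abs, abs_le]
    exact ⟨le_max_left _ _, max_le (by linarith [M.2]) (min_le_left _ _)⟩

set_option maxHeartbeats 2000000 in
theorem stmt12
    {n m : ℕ} (hn : 0 < n) (hm : 0 < m)
    (f : (Fin n → ℝ) → (Fin m → ℝ) → (Fin n → ℝ)) (g : (Fin n → ℝ) → (Fin m → ℝ))
    (hf : Continuous (fun p : (Fin n → ℝ) × (Fin m → ℝ) => f p.1 p.2)) (hg : Continuous g)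
    (hf0 : f 0 (g 0) = 0)
    -- Assumption 1
    (Ncl : (Fin n → ℝ) → ℝ) (hNcl : IsVecNorm Ncl) (c R₁ : ℝ) (hc : 0 < c) (hR₁ : 0 < R₁)
    (hLip : ∀ x ∈ nball Ncl R₁, ∃ (K : NNReal) (ε : ℝ), 0 < ε ∧
      LipschitzOnWith K (fun y => f y (g y)) (Metric.ball x ε ∩ nball Ncl R₁))
    (hmucl : ∀ᵐ x ∂(volume : Measure (Fin n → ℝ)), x ∈ nball Ncl R₁ →
      DifferentiableAt ℝ (fun y => f y (g y)) x ∧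
      logNorm Ncl (jacobian (fun y => f y (g y)) x) ≤ -c)
    -- Assumption 2
    (Nop : (Fin n → ℝ) → ℝ) (hNop : IsVecNorm Nop) (d₁ d₂ R₂ : ℝ)
    (hd₁ : 0 ≤ d₁) (hd₂ : 0 < d₂) (hR₂ : 0 < R₂)
    (hC1 : ∀ q ∈ nball Nop R₂, ContDiffOn ℝ 1 (fun x => f x (g q)) (nball Nop R₂))
    (hmuop : ∀ q ∈ nball Nop R₂, ∀ x ∈ nball Nop R₂,
      logNorm Nop (jacobian (fun y => f y (g q)) x) ≤ d₁)
    (hfqq : ∀ q ∈ nball Nop R₂, Nop (f q (g q)) ≤ d₂ * Nop q)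
    -- the constants Γ and R
    (Γ R : ℝ) (hΓ : 0 < Γ) (hΓle : ∀ x : Fin n → ℝ, Nop x ≤ Γ * Ncl x)
    (hR : R = min R₁ (R₂ / Γ))
    -- Assumption 3
    (α σ₀ : ℝ) (hα : 0 < α) (hσ₀ : 0 < σ₀)
    (hFLip : ∀ x ∈ nball Ncl R, ∀ e ∈ nball Nop (σ₀ * R),
      Ncl (f x (g (x + e)) - f x (g x)) ≤ α * Nop e)
    -- equivalence of ‖·‖_cl with a diagonally-weighted ∞-norm
    (θcl : Fin n → ℝ) (hθcl : ∀ i, 0 < θcl i)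
    (Lcl1 Lcl2 : ℝ) (hLcl1 : 0 < Lcl1) (hLcl2 : 0 < Lcl2)
    (hclEquiv : ∀ x : Fin n → ℝ,
      Lcl1 * wnorm ⊤ θcl x ≤ Ncl x ∧ Ncl x ≤ Lcl2 * wnorm ⊤ θcl x)
    (Lcl : ℝ) (hLcl : Lcl = Lcl2 / Lcl1)
    -- equivalence of ‖·‖_op with a diagonally-weighted r-norm
    (θop : Fin n → ℝ) (hθop : ∀ i, 0 < θop i) (r : ℝ≥0∞) (hr : 1 ≤ r)
    (Lop1 Lop2 : ℝ) (hLop1 : 0 < Lop1) (hLop2 : 0 < Lop2)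
    (hopEquiv : ∀ x : Fin n → ℝ,
      Lop1 * wnorm r θop x ≤ Nop x ∧ Nop x ≤ Lop2 * wnorm r θop x)
    (Lop : ℝ) (hLop : Lop = Lop2 / Lop1)
    (ρ : ℝ) (hρ : 0 < ρ ∧ ρ < 1)
    -- Assumption 4
    (χ₀ : ℝ) (hχ₀pos : 0 < χ₀) (hχ₀ : R / Lcl2 ≤ χ₀ ∧ χ₀ < 2 * R / (Lcl2 * (1 + ρ)))
    -- the logarithmic quantizer with density ρ and parameters χ_{i,0} = χ₀ / θcl i
    (Qlog : (Fin n → ℝ) → (Fin n → ℝ))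
    (hQ0 : ∀ (x : Fin n → ℝ) (i : Fin n), x i = 0 → Qlog x i = 0)
    (hQpos : ∀ (x : Fin n → ℝ) (i : Fin n) (j : ℤ),
      ρ ^ (j + 1) * (χ₀ / θcl i) ≤ x i → x i < ρ ^ j * (χ₀ / θcl i) →
      Qlog x i = (ρ ^ j * (χ₀ / θcl i) + ρ ^ (j + 1) * (χ₀ / θcl i)) / 2)
    (hQneg : ∀ (x : Fin n → ℝ) (i : Fin n), x i < 0 → Qlog x i = - Qlog (-x) i)
    -- `X q` is the (predicted) trajectory of the open-loop system starting at `q`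
    (X : (Fin n → ℝ) → ℝ → (Fin n → ℝ))
    (hX : ∀ qq : Fin n → ℝ, Continuous (X qq) ∧ X qq 0 = qq ∧
      ∀ s : ℝ, 0 ≤ s → Nop (X qq s) < R₂ →
        HasDerivWithinAt (X qq) (f (X qq s) (g qq)) (Set.Ici 0) s)
    (σ σ₁ : ℝ) (hσpos : 0 < σ) (hσub : σ ≤ σ₀)
    (hσ₁ : σ₁ = 2 * c * ρ / (α * Lcl * (1 + ρ)))
    (hcond : Γ * Lop * (1 - ρ) / (1 + ρ) < σ ∧ σ < σ₁)
    (τmax : ℝ) (hτmax : 0 < τmax)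
    (γ : ℝ) (hγ : γ = -(1 / τmax) *
      Real.log (Real.exp (-c * τmax) * (1 - σ / σ₁) + σ / σ₁))
    (x₀ : Fin n → ℝ) (hx₀ : Ncl x₀ < R / Lcl)
    (q₀ : Fin n → ℝ) (hq₀ : q₀ = Qlog x₀)
    (t₁ : ℝ) (ht₁ : t₁ = tauSamp Ncl Nop R₂ τmax σ d₁ Lop ρ X q₀) :
    0 < t₁ ∧
    ∃ x : ℝ → (Fin n → ℝ),
      (x 0 = x₀ ∧ ∀ s ∈ Set.Icc (0:ℝ) t₁, HasDerivWithinAt x (f (x s) (g q₀)) (Set.Icc 0 t₁) s) ∧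
      (∀ y : ℝ → (Fin n → ℝ), y 0 = x₀ →
        (∀ s ∈ Set.Icc (0:ℝ) t₁, HasDerivWithinAt y (f (y s) (g q₀)) (Set.Icc 0 t₁) s) →
        ∀ s ∈ Set.Icc (0:ℝ) t₁, y s = x s) ∧
      (∀ s ∈ Set.Icc (0:ℝ) t₁, Ncl (x s) ≤ Real.exp (-γ * s) * Ncl x₀) := by
  obtain ⟨hρ0, hρ1⟩ := hρ
  -- basic constants
  have hRpos : 0 < R := by rw [hR]; exact lt_min hR₁ (div_pos hR₂ hΓ)
  have hRR₁ : R ≤ R₁ := by rw [hR]; exact min_le_left _ _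
  have hΓR : Γ * R ≤ R₂ := by
    have : R ≤ R₂ / Γ := by rw [hR]; exact min_le_right _ _
    rwa [le_div_iff₀ hΓ, mul_comm] at this
  have hLclpos : 0 < Lcl := by rw [hLcl]; positivity
  have hLoppos : 0 < Lop := by rw [hLop]; positivity
  have hLcl_one : 1 ≤ Lcl := by
    set one : Fin n → ℝ := fun _ => 1 with hone
    have hne : one ≠ 0 := fun h => by
      have := congrFun h ⟨0, hn⟩
      simp [hone] at this
    obtain ⟨h1, h2⟩ := hclEquiv one
    have hp := hNcl.pos hne
    have hw : 0 < wnorm ⊤ θcl one := by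
      by_contra hw
      have := mul_nonpos_of_nonneg_of_nonpos hLcl2.le (not_lt.1 hw)
      linarith
    rw [hLcl, le_div_iff₀ hLcl1, one_mul]
    exact le_of_mul_le_mul_right (h1.trans h2) hw
  have hx₀R : Ncl x₀ < R := hx₀.trans_le (div_le_self hRpos.le hLcl_one)
  have hcl_op : ∀ z : Fin n → ℝ, Ncl z < R → Nop z < R₂ := fun z hz =>
    ((hΓle z).trans_lt (mul_lt_mul_of_pos_left hz hΓ)).trans_le hΓR
  -- quantization
  have hxi : ∀ i, |x₀ i| < χ₀ / θcl i := by
    intro i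
    rw [lt_div_iff₀ (hθcl i)]
    have h1 : |x₀ i| * θcl i ≤ wnorm ⊤ θcl x₀ := by
      rw [wnorm_top]
      have := norm_le_pi_norm (fun i => θcl i * x₀ i) i
      rw [Real.norm_eq_abs, abs_mul, abs_of_pos (hθcl i)] at this
      linarith
    have h2 : Lcl1 * wnorm ⊤ θcl x₀ < R / Lcl := (hclEquiv x₀).1.trans_lt hx₀
    have h3 : wnorm ⊤ θcl x₀ < R / Lcl2 := by
      have e : R / Lcl = Lcl1 * (R / Lcl2) := by rw [hLcl]; field_simp
      rw [e] at h2
      exact lt_of_mul_lt_mul_left h2 hLcl1.le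
    linarith [hχ₀.1]
  have hquant : ∀ i, |q₀ i - x₀ i| ≤ (1 - ρ) / (1 + ρ) * |q₀ i| ∧
      |q₀ i| ≤ (1 + ρ) / (2 * ρ) * |x₀ i| ∧ |q₀ i| ≤ (1 + ρ) / 2 * (χ₀ / θcl i) := by
    intro i
    rw [hq₀]
    exact quant hθcl ⟨hρ0, hρ1⟩ hχ₀pos Qlog hQ0 hQpos hQneg x₀ i (hxi i)
  have hk0 : 0 ≤ (1 - ρ) / (1 + ρ) := div_nonneg (by linarith) (by linarith)
  have hqx_op : Nop (x₀ - q₀) ≤ Lop * (1 - ρ) / (1 + ρ) * Nop q₀ := by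
    rw [hNop.sub_rev]
    have h1 := (hopEquiv (q₀ - x₀)).2
    have h2 : wnorm r θop (q₀ - x₀) ≤ (1 - ρ) / (1 + ρ) * wnorm r θop q₀ :=
      wnorm_mono hr θop hk0 fun i => (hquant i).1
    have h3 := (hopEquiv q₀).1
    calc Nop (q₀ - x₀) ≤ Lop2 * wnorm r θop (q₀ - x₀) := h1
      _ ≤ Lop2 * ((1 - ρ) / (1 + ρ) * wnorm r θop q₀) := by gcongr
      _ = Lop2 / Lop1 * ((1 - ρ) / (1 + ρ)) * (Lop1 * wnorm r θop q₀) := by field_simp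
      _ ≤ Lop2 / Lop1 * ((1 - ρ) / (1 + ρ)) * Nop q₀ := by gcongr
      _ = Lop * (1 - ρ) / (1 + ρ) * Nop q₀ := by rw [hLop]; ring
  have hq_cl : Ncl q₀ ≤ Lcl * (1 + ρ) / (2 * ρ) * Ncl x₀ := by
    have h2 : wnorm ⊤ θcl q₀ ≤ (1 + ρ) / (2 * ρ) * wnorm ⊤ θcl x₀ :=
      wnorm_mono le_top θcl (by positivity) fun i => (hquant i).2.1
    have h3 := (hclEquiv x₀).1
    calc Ncl q₀ ≤ Lcl2 * wnorm ⊤ θcl q₀ := (hclEquiv q₀).2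
      _ ≤ Lcl2 * ((1 + ρ) / (2 * ρ) * wnorm ⊤ θcl x₀) := by gcongr
      _ = Lcl2 / Lcl1 * ((1 + ρ) / (2 * ρ)) * (Lcl1 * wnorm ⊤ θcl x₀) := by field_simp
      _ ≤ Lcl2 / Lcl1 * ((1 + ρ) / (2 * ρ)) * Ncl x₀ := by gcongr
      _ = Lcl * (1 + ρ) / (2 * ρ) * Ncl x₀ := by rw [hLcl]; ring
  have hq_R : Ncl q₀ < R := by
    have h1 : wnorm ⊤ θcl q₀ ≤ (1 + ρ) / 2 * χ₀ := by
      rw [wnorm_top]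
      refine (pi_norm_le_iff_of_nonneg (by positivity)).2 fun i => ?_
      rw [Real.norm_eq_abs, abs_mul, abs_of_pos (hθcl i)]
      have h0 := hθcl i
      calc θcl i * |q₀ i| ≤ θcl i * ((1 + ρ) / 2 * (χ₀ / θcl i)) := by
            gcongr; exact (hquant i).2.2
        _ = (1 + ρ) / 2 * χ₀ := by field_simp
    have h2 := hχ₀.2
    rw [lt_div_iff₀ (by positivity)] at h2
    have h3 : Lcl2 * wnorm ⊤ θcl q₀ ≤ Lcl2 * ((1 + ρ) / 2 * χ₀) := by gcongr
    have h4 := (hclEquiv q₀).2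
    nlinarith
  have hq_op : Nop q₀ < R₂ := hcl_op q₀ hq_R
  -- the open loop vector field
  set G : (Fin n → ℝ) → (Fin n → ℝ) := fun x => f x (g q₀) with hGdef
  have hGc : Continuous G := hf.comp (by fun_prop : Continuous fun x => (x, g q₀))
  have hosl_op : ∀ x ∈ nball Nop R₂, ∀ y ∈ nball Nop R₂, ∀ l : (Fin n → ℝ) →ₗ[ℝ] ℝ,
      (∀ z, l z ≤ Nop z) → l (x - y) = Nop (x - y) → l (G x - G y) ≤ d₁ * Nop (x - y) := by
    intro x hx y hy l hl hlv
    have hO := hNop.isOpen_nball R₂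
    refine osl hNop hO (hNop.convex_nball R₂)
      ((hC1 q₀ hq_op).locallyLipschitzOn (hNop.convex_nball R₂)) (Eventually.of_forall ?_)
      hx hy l hl hlv
    intro z hz
    exact ⟨((hC1 q₀ hq_op).differentiableOn one_ne_zero).differentiableAt (hO.mem_nhds hz),
      hmuop q₀ hq_op z hz⟩
  obtain ⟨hXc, hX0, hXd⟩ := hX q₀
  -- timing
  obtain ⟨δ, hδ, hpsi⟩ : ∃ δ : ℝ, 0 < δ ∧
      ∀ s ∈ Ico 0 δ, psiLog Nop d₁ Lop ρ X s q₀ ≤ σ * Ncl q₀ := by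
    rcases eq_or_ne q₀ 0 with hq0 | hqne
    · have hev : ∀ᶠ s in 𝓝 (0:ℝ), Nop (X q₀ s) < R₂ :=
        (hNop.continuous.comp hXc).continuousAt.eventually_lt_const
          (by simp only [Function.comp, hX0]; exact hq_op)
      obtain ⟨η, hη, hball⟩ := Metric.eventually_nhds_iff.1 hev
      refine ⟨η, hη, fun s hs => ?_⟩
      have hin : ∀ t ∈ Ico 0 η, Nop (X q₀ t) < R₂ := fun t ht =>
        hball (by rw [Real.dist_eq, sub_zero, abs_of_nonneg ht.1]; exact ht.2)
      have hG0 : G 0 = 0 := by simp only [hGdef, hq0, hf0]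
      have := op_estimate hNop hGc hosl_op (x := X q₀) (y := fun _ => 0) (b := η)
        hXc.continuousOn continuousOn_const
        (fun t ht => (hXd t ht.1 (hin t ht)).mono (Ici_subset_Ici.2 ht.1))
        (fun t _ => by rw [hG0]; exact hasDerivWithinAt_const _ _ _)
        hin (fun t _ => by show Nop 0 < R₂; rw [hNop.zero]; exact hR₂) s ⟨hs.1, hs.2.le⟩
      rw [hX0, hq0, sub_zero, sub_zero, hNop.zero, zero_mul] at this
      unfold psiLog
      rw [hq0, hNop.zero, hNcl.zero, sub_zero]
      linarith
    · have hqp := hNcl.pos hqne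
      have hψc : Continuous fun s => psiLog Nop d₁ Lop ρ X s q₀ := by
        have := hNop.continuous
        unfold psiLog
        fun_prop
      have hψ0 : psiLog Nop d₁ Lop ρ X 0 q₀ < σ * Ncl q₀ := by
        unfold psiLog
        rw [hX0, sub_self, hNop.zero, mul_zero, Real.exp_zero, mul_one, add_zero]
        have hL0 : 0 ≤ Lop * (1 - ρ) / (1 + ρ) := by
          rw [mul_div_assoc]; positivity
        calc Lop * (1 - ρ) / (1 + ρ) * Nop q₀ ≤ Lop * (1 - ρ) / (1 + ρ) * (Γ * Ncl q₀) := by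
              gcongr; exact hΓle q₀
          _ = Γ * Lop * (1 - ρ) / (1 + ρ) * Ncl q₀ := by ring
          _ < σ * Ncl q₀ := by gcongr; exact hcond.1
      obtain ⟨η, hη, hball⟩ := Metric.eventually_nhds_iff.1
        (hψc.continuousAt.eventually_lt_const hψ0)
      refine ⟨η, hη, fun s hs => (hball ?_).le⟩
      rw [Real.dist_eq, sub_zero, abs_of_nonneg hs.1]; exact hs.2
  obtain ⟨ht₁pos, ht₁max, ht₁s⟩ := timing (Ncl := Ncl) (σ := σ) hNop hXc hX0 hq_op hτmax hδ hpsi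
  rw [← ht₁] at ht₁pos ht₁max ht₁s
  -- closed loop one-sided Lipschitz
  have hosl_cl : ∀ x ∈ nball Ncl R₁, ∀ l : (Fin n → ℝ) →ₗ[ℝ] ℝ,
      (∀ z, l z ≤ Ncl z) → l x = Ncl x → l (f x (g x)) ≤ -c * Ncl x := by
    intro x hx l hl hlv
    have hLL : LocallyLipschitzOn (nball Ncl R₁) (fun y => f y (g y)) := by
      intro z hz
      obtain ⟨K, ε, hε, hK⟩ := hLip z hz
      exact ⟨K, _, Filter.inter_mem (mem_nhdsWithin_of_mem_nhds (Metric.ball_mem_nhds z hε))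
        self_mem_nhdsWithin, hK⟩
    have := osl hNcl (hNcl.isOpen_nball R₁) (hNcl.convex_nball R₁) hLL hmucl hx
      (show (0 : Fin n → ℝ) ∈ nball Ncl R₁ by
        show Ncl 0 < R₁
        rw [hNcl.zero]; exact hR₁) l hl (by rw [sub_zero]; exact hlv)
    simpa only [hf0, sub_zero] using this
  -- a priori estimate
  set κ := σ / σ₁ with hκ
  have hσ₁pos : 0 < σ₁ := hσpos.trans hcond.2
  have hκ0 : 0 < κ := div_pos hσpos hσ₁pos
  have hκ1 : κ < 1 := (div_lt_one hσ₁pos).2 hcond.2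
  have hαq : α * (σ * Ncl q₀) ≤ c * κ * Ncl x₀ := by
    calc α * (σ * Ncl q₀) ≤ α * (σ * (Lcl * (1 + ρ) / (2 * ρ) * Ncl x₀)) := by gcongr
      _ = c * κ * Ncl x₀ := by rw [hκ, hσ₁]; field_simp
  have hNx₀ := hNcl.nonneg x₀
  have hest : ∀ (b : ℝ), 0 < b → b ≤ t₁ → ∀ y : ℝ → (Fin n → ℝ), y 0 = x₀ →
      ContinuousOn y (Icc 0 b) → (∀ t ∈ Ico 0 b, HasDerivWithinAt y (G (y t)) (Ici t) t) →
      (∀ t ∈ Ico 0 b, Ncl (y t) < R) →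
      ∀ t ∈ Icc 0 b, Ncl (y t) ≤ (Real.exp (-c * t) * (1 - κ) + κ) * Ncl x₀ := by
    intro b hb hbt y hy0 hyc hyd hyR
    have hXin : ∀ t ∈ Ico 0 b, Nop (X q₀ t) < R₂ := fun t ht =>
      (ht₁s t ⟨ht.1, ht.2.trans_le hbt⟩).1
    have hop := op_estimate hNop hGc hosl_op (x := y) (y := X q₀) (b := b) hyc
      hXc.continuousOn hyd
      (fun t ht => (hXd t ht.1 (hXin t ht)).mono (Ici_subset_Ici.2 ht.1))
      (fun t ht => hcl_op _ (hyR t ht)) hXin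
    rw [hy0, hX0] at hop
    have herr : ∀ t ∈ Ico 0 b, Nop (q₀ - y t) ≤ σ * Ncl q₀ := by
      intro t ht
      have h1 := hop t ⟨ht.1, ht.2.le⟩
      have h2 := (ht₁s t ⟨ht.1, ht.2.trans_le hbt⟩).2
      unfold psiLog at h2
      have h3 := hNop.add_le (y t - X q₀ t) (X q₀ t - q₀)
      rw [sub_add_sub_cancel, hNop.sub_rev] at h3
      have h4 := mul_le_mul_of_nonneg_right hqx_op (Real.exp_pos (d₁ * t)).le
      linarith
    have hgr := norm_gronwall hNcl (v := y) (v' := fun t => G (y t)) (b := b) (K := -c)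
      (ε := c * κ * Ncl x₀) hyc (hGc.comp_continuousOn hyc) hyd ?_
    · intro t ht
      have h1 := hgr t ht
      rw [gronwallBound_of_K_ne_0 (by linarith), hy0] at h1
      refine h1.trans (le_of_eq ?_)
      field_simp
      ring
    · intro t ht l hl hlv
      have h1 := hosl_cl (y t) (lt_of_lt_of_le (hyR t ht) hRR₁) l hl hlv
      have h2 := hFLip (y t) (hyR t ht) (q₀ - y t) (by
        show Nop (q₀ - y t) < σ₀ * R
        calc Nop (q₀ - y t) ≤ σ * Ncl q₀ := herr t ht
          _ < σ * R := by gcongr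
          _ ≤ σ₀ * R := by gcongr)
      rw [add_sub_cancel] at h2
      have h3 := hl (f (y t) (g q₀) - f (y t) (g (y t)))
      rw [map_sub] at h3
      have h4 : α * Nop (q₀ - y t) ≤ α * (σ * Ncl q₀) := by
        have := herr t ht
        gcongr
      show l (f (y t) (g q₀)) ≤ _
      linarith
  have hbd : ∀ t, 0 ≤ t → (Real.exp (-c * t) * (1 - κ) + κ) * Ncl x₀ ≤ Ncl x₀ := by
    intro t ht
    have h1 : Real.exp (-c * t) ≤ 1 := Real.exp_le_one_iff.2 (by
      have := mul_nonneg hc.le ht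
      rw [neg_mul]; linarith)
    have h2 : Real.exp (-c * t) * (1 - κ) + κ ≤ 1 := by nlinarith
    nlinarith
  obtain ⟨R', hR'1, hR'2⟩ := exists_between hx₀R
  -- vector fields agreeing with `G` on the closed ball of radius `R'`
  have hmain : ∀ H : (Fin n → ℝ) → (Fin n → ℝ), (∀ z, Ncl z ≤ R' → H z = G z) →
      ∀ y : ℝ → (Fin n → ℝ), y 0 = x₀ →
      (∀ s ∈ Icc (0:ℝ) t₁, HasDerivWithinAt y (H (y s)) (Icc 0 t₁) s) →
      ∀ s ∈ Icc (0:ℝ) t₁, Ncl (y s) ≤ R' ∧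
        Ncl (y s) ≤ (Real.exp (-c * s) * (1 - κ) + κ) * Ncl x₀ := by
    intro H hH y hy0 hyd
    have hyc : ContinuousOn y (Icc 0 t₁) := fun s hs => (hyd s hs).continuousWithinAt
    have hyd' : ∀ b, b ≤ t₁ → (∀ s ∈ Ico 0 b, Ncl (y s) < R') →
        ∀ t ∈ Ico 0 b, HasDerivWithinAt y (G (y t)) (Ici t) t := by
      intro b hb hR t ht
      have htI : t ∈ Ico 0 t₁ := ⟨ht.1, ht.2.trans_le hb⟩
      have h1 := hyd t ⟨htI.1, htI.2.le⟩
      rw [hH _ (hR t ht).le] at h1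
      exact h1.mono_of_mem_nhdsWithin (Icc_mem_nhdsGE_of_mem htI)
    have hlt := first_exit (u := fun s => Ncl (y s)) (T := t₁) (R := R')
      (hNcl.continuous.comp_continuousOn hyc) (by simp only [hy0]; exact hR'1)
      (fun b hb hbt hR => by
        have := hest b hb hbt y hy0 (hyc.mono (Icc_subset_Icc_right hbt)) (hyd' b hbt hR)
          (fun t ht => (hR t ht).trans hR'2) b ⟨hb.le, le_rfl⟩
        exact (this.trans (hbd b hb.le)).trans_lt hR'1)
    intro s hs
    refine ⟨(hlt s hs).le, ?_⟩
    have hR : ∀ s ∈ Ico 0 t₁, Ncl (y s) < R' := fun s hs => hlt s ⟨hs.1, hs.2.le⟩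
    exact hest t₁ ht₁pos le_rfl y hy0 hyc (hyd' t₁ le_rfl hR)
      (fun t ht => (hR t ht).trans hR'2) s hs
  have hKsub : {z | Ncl z ≤ R'} ⊆ nball Nop R₂ := fun z hz => hcl_op z (lt_of_le_of_lt hz hR'2)
  obtain ⟨K, hK⟩ := ((hC1 q₀ hq_op).mono hKsub).exists_lipschitzOnWith one_ne_zero
    (hNcl.convex_le R') (hNcl.isCompact_le R')
  obtain ⟨G', M, hG'L, hG'e, hG'M⟩ := exists_extension (hNcl.isCompact_le R') hK
  obtain ⟨x, hx0, hxd⟩ := exists_sol hG'L hG'M x₀ ht₁pos.le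
  have hxm := hmain G' (fun z hz => (hG'e hz).symm) x hx0 hxd
  refine ⟨ht₁pos, x, ⟨hx0, fun s hs => ?_⟩, ?_, ?_⟩
  · have h1 := hxd s hs
    rwa [← hG'e (hxm s hs).1] at h1
  · intro y hy0 hyd
    have hym := hmain G (fun _ _ => rfl) y hy0 hyd
    have hyd' : ∀ s ∈ Icc (0:ℝ) t₁, HasDerivWithinAt y (G' (y s)) (Icc 0 t₁) s := by
      intro s hs
      rw [← hG'e (hym s hs).1]
      exact hyd s hs
    have hEq := ODE_solution_unique_of_mem_Icc_right (v := fun _ => G') (s := fun _ => univ)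
      (K := K) (a := 0) (b := t₁) (f := y) (g := x) (fun _ _ => hG'L.lipschitzOnWith)
      (fun s hs => (hyd s hs).continuousWithinAt)
      (fun t ht => (hyd' t ⟨ht.1, ht.2.le⟩).mono_of_mem_nhdsWithin (Icc_mem_nhdsGE_of_mem ht))
      (fun _ _ => mem_univ _)
      (fun s hs => (hxd s hs).continuousWithinAt)
      (fun t ht => (hxd t ⟨ht.1, ht.2.le⟩).mono_of_mem_nhdsWithin (Icc_mem_nhdsGE_of_mem ht))
      (fun _ _ => mem_univ _) (by rw [hy0, hx0])
    exact hEq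
  · intro s hs
    refine (hxm s hs).2.trans ?_
    rw [hγ]
    exact mul_le_mul_of_nonneg_right
      (cl_bound_le hτmax hκ0 hκ1 ⟨hs.1, hs.2.trans ht₁max⟩) hNx₀

end
end

section
/- For any θ ∈ ℝ^n_{>0} and c > 0, the inequality sup_{x ∈ C_η} μ_{∞,[θ]}(DF₀(x)) ≤ −c holds if and only if both entrywise vector inequalities ⌈(A+BK) + κ_min ξηᵀ⌉_Mzr θ^{−1} ≤ −c θ^{−1} and ⌈(A+BK) + κ_max ξηᵀ⌉_Mzr θ^{−1} ≤ −c θ^{−1} hold. -/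
set_option autoImplicit false

open Filter Set Real Matrix
open scoped Topology ENNReal

noncomputable section

/-- Diagonally-weighted ∞-norm `‖x‖_{∞,[θ]} = ‖[θ]x‖_∞` (the sup-norm of `[θ]x`). -/
def winf {n : ℕ} (θ x : Fin n → ℝ) : ℝ := ‖(fun i => θ i * x i : Fin n → ℝ)‖

/-- The Metzler majorant of a matrix. -/
def mzr {n : ℕ} (M : Matrix (Fin n) (Fin n) ℝ) : Matrix (Fin n) (Fin n) ℝ :=
  Matrix.of fun i j => if i = j then M i j else |M i j|

lemma matNorm_aux {n : ℕ} (hn : 0 < n) (θ : Fin n → ℝ) (hθ : ∀ i, 0 < θ i)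
    (P : Matrix (Fin n) (Fin n) ℝ) (L : ℝ)
    (hL : ∀ i, θ i * ∑ j, |P i j| * (θ j)⁻¹ ≤ L)
    (i₀ : Fin n) (hi₀ : θ i₀ * ∑ j, |P i₀ j| * (θ j)⁻¹ = L) :
    matNorm (fun y => winf θ y) P = L := by
  have hL0 : 0 ≤ L := by
    rw [← hi₀]
    exact mul_nonneg (hθ i₀).le (Finset.sum_nonneg fun j _ =>
      mul_nonneg (abs_nonneg _) (inv_nonneg.2 (hθ j).le))
  have upper : ∀ x : Fin n → ℝ, winf θ x = 1 → winf θ (P.mulVec x) ≤ L := by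
    intro x hx
    unfold winf at *
    refine (pi_norm_le_iff_of_nonneg hL0).2 fun i => le_trans ?_ (hL i)
    rw [Real.norm_eq_abs, abs_mul, abs_of_pos (hθ i)]
    refine mul_le_mul_of_nonneg_left ?_ (hθ i).le
    simp only [Matrix.mulVec, dotProduct]
    refine (Finset.abs_sum_le_sum_abs (fun j => P i j * x j) Finset.univ).trans
      (Finset.sum_le_sum fun j _ => ?_)
    rw [abs_mul]
    refine mul_le_mul_of_nonneg_left ?_ (abs_nonneg _)
    have h1 := norm_le_pi_norm (fun i => θ i * x i : Fin n → ℝ) j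
    rw [hx, Real.norm_eq_abs, abs_mul, abs_of_pos (hθ j)] at h1
    rw [← one_div, le_div_iff₀ (hθ j)]
    linarith
  unfold matNorm
  refine IsGreatest.csSup_eq ⟨?_, ?_⟩
  · let s : Fin n → ℝ := fun j => if 0 ≤ P i₀ j then 1 else -1
    have hs : ∀ j, |s j| = 1 := by
      intro j
      by_cases h : 0 ≤ P i₀ j <;> simp [s, h]
    have hsP : ∀ j, P i₀ j * s j = |P i₀ j| := by
      intro j
      by_cases h : 0 ≤ P i₀ j
      · simp [s, h, abs_of_nonneg h]
      · simp [s, h, abs_of_neg (not_le.1 h)]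
    have hx1 : winf θ (fun j => s j * (θ j)⁻¹) = 1 := by
      unfold winf
      have he : ∀ j, θ j * (s j * (θ j)⁻¹) = s j := by
        intro j
        have := (hθ j).ne'
        field_simp
      simp only [he]
      apply le_antisymm
      · exact (pi_norm_le_iff_of_nonneg zero_le_one).2 fun j => (hs j).le
      · have := norm_le_pi_norm s i₀
        rw [Real.norm_eq_abs, hs] at this
        exact this
    refine ⟨_, hx1, le_antisymm ?_ (upper _ hx1)⟩
    rw [← hi₀]
    unfold winf
    refine le_trans ?_ (norm_le_pi_norm _ i₀)
    rw [Real.norm_eq_abs]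
    refine le_trans (le_of_eq ?_) (le_abs_self _)
    congr 1
    refine Finset.sum_congr rfl fun j _ => ?_
    rw [← hsP j]
    ring
  · rintro _ ⟨x, hx, rfl⟩
    exact upper x hx

lemma logNorm_le_iff {n : ℕ} (hn : 0 < n) (θ : Fin n → ℝ) (hθ : ∀ i, 0 < θ i)
    (M : Matrix (Fin n) (Fin n) ℝ) (c : ℝ) :
    logNorm (fun y => winf θ y) M ≤ -c ↔
      (mzr M).mulVec (fun i => (θ i)⁻¹) ≤ (-c) • (fun i => (θ i)⁻¹) := by
  haveI : Nonempty (Fin n) := ⟨⟨0, hn⟩⟩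
  let g : Fin n → ℝ := fun i => θ i * (mzr M).mulVec (fun i => (θ i)⁻¹) i
  obtain ⟨i₀, hi₀⟩ := Finite.exists_max g
  have row : ∀ ε : ℝ, 0 < ε → ∀ i, 0 ≤ 1 + ε * M i i →
      θ i * ∑ j, |(1 + ε • M) i j| * (θ j)⁻¹ = 1 + ε * g i := by
    intro ε hε i hi
    have e : ∀ j, |(1 + ε • M) i j| * (θ j)⁻¹ =
        (if i = j then (θ j)⁻¹ else 0) + ε * (mzr M i j * (θ j)⁻¹) := by
      intro j
      by_cases h : i = j
      · subst h
        simp [mzr, abs_of_nonneg hi]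
        ring
      · simp [mzr, h, Matrix.one_apply, abs_mul, abs_of_pos hε]
        ring
    simp only [e, Finset.sum_add_distrib, ← Finset.mul_sum]
    simp only [Finset.sum_ite_eq, Finset.mem_univ, if_true, g, Matrix.mulVec, dotProduct]
    have := (hθ i).ne'
    field_simp
  have hlog : logNorm (fun y => winf θ y) M = g i₀ := by
    unfold logNorm
    apply Tendsto.limUnder_eq
    refine tendsto_const_nhds.congr' ?_
    have h2 : ∀ᶠ ε in 𝓝[>] (0 : ℝ), ∀ i, 0 ≤ 1 + ε * M i i := by
      rw [eventually_all]
      intro i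
      apply nhdsWithin_le_nhds
      have hc : ContinuousAt (fun ε : ℝ => 1 + ε * M i i) 0 := by fun_prop
      have := hc.eventually (lt_mem_nhds (show (0 : ℝ) < 1 + 0 * M i i by simp))
      exact this.mono fun _ h => le_of_lt h
    filter_upwards [h2, self_mem_nhdsWithin] with ε h1 hε
    have hε : 0 < ε := hε
    rw [matNorm_aux hn θ hθ (1 + ε • M) (1 + ε * g i₀) ?_ i₀ (row ε hε i₀ (h1 i₀))]
    · field_simp
      ring
    · intro i
      rw [row ε hε i (h1 i)]
      have := mul_le_mul_of_nonneg_left (hi₀ i) hε.le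
      linarith
  rw [hlog, Pi.le_def]
  have key : ∀ i, g i ≤ -c ↔ (mzr M).mulVec (fun i => (θ i)⁻¹) i ≤
      ((-c) • (fun i => (θ i)⁻¹ : Fin n → ℝ)) i := by
    intro i
    simp only [Pi.smul_apply, smul_eq_mul, g]
    rw [← div_eq_mul_inv, le_div_iff₀ (hθ i), mul_comm]
  simp only [← key]
  exact ⟨fun h i => (hi₀ i).trans h, fun h => h i₀⟩

lemma jacobian_lure {n : ℕ} (M : Matrix (Fin n) (Fin n) ℝ) (ξ η : Fin n → ℝ)
    (φ : ℝ → ℝ) (hφ : ContDiff ℝ 1 φ) (x : Fin n → ℝ) :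
    jacobian (fun y => M.mulVec y + φ (η ⬝ᵥ y) • ξ) x =
      M + deriv φ (η ⬝ᵥ x) • Matrix.vecMulVec ξ η := by
  let l : (Fin n → ℝ) →L[ℝ] ℝ := LinearMap.toContinuousLinearMap
    { toFun := fun y => η ⬝ᵥ y
      map_add' := fun a b => dotProduct_add _ _ _
      map_smul' := fun a b => by simp }
  have hl : HasFDerivAt (fun y : Fin n → ℝ => η ⬝ᵥ y) l x := l.hasFDerivAt
  let T : (Fin n → ℝ) →L[ℝ] (Fin n → ℝ) := LinearMap.toContinuousLinearMap M.mulVecLin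
  have hT : HasFDerivAt (fun y : Fin n → ℝ => M.mulVec y) T x := T.hasFDerivAt
  have hd : HasDerivAt φ (deriv φ (η ⬝ᵥ x)) (η ⬝ᵥ x) :=
    (hφ.differentiable (by norm_num) _).hasDerivAt
  have h2 := (hd.comp_hasFDerivAt x hl).smul_const ξ
  have h3 := hT.add h2
  ext i j
  unfold jacobian
  rw [Matrix.of_apply]
  have h4 : fderiv ℝ (fun y => M.mulVec y + φ (η ⬝ᵥ y) • ξ) x = _ := h3.fderiv
  rw [h4]
  have e1 : T (Pi.single j 1) i = M i j := by
    change M.mulVec (Pi.single j 1) i = M i j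
    simp
  have e2 : l (Pi.single j 1) = η j := by
    change η ⬝ᵥ (Pi.single j 1) = η j
    simp
  simp [e1, e2, Matrix.vecMulVec_apply]
  ring

lemma mzr_convex {n : ℕ} (M N : Matrix (Fin n) (Fin n) ℝ) (v w : Fin n → ℝ)
    (hv : ∀ i, 0 ≤ v i) :
    Convex ℝ {κ : ℝ | (mzr (M + κ • N)).mulVec v ≤ w} := by
  intro p hp q hq a b ha hb hab
  simp only [Set.mem_setOf_eq, Pi.le_def] at *
  intro i
  have h1 := mul_le_mul_of_nonneg_left (hp i) ha
  have h2 := mul_le_mul_of_nonneg_left (hq i) hb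
  have h3 : (mzr (M + (a • p + b • q) • N)).mulVec v i ≤
      a * (mzr (M + p • N)).mulVec v i + b * (mzr (M + q • N)).mulVec v i := by
    simp only [Matrix.mulVec, dotProduct, Finset.mul_sum, ← Finset.sum_add_distrib]
    refine Finset.sum_le_sum fun j _ => ?_
    rw [← mul_assoc, ← mul_assoc, ← add_mul]
    refine mul_le_mul_of_nonneg_right ?_ (hv j)
    have e : M i j + (a * p + b * q) * N i j =
        a * (M i j + p * N i j) + b * (M i j + q * N i j) := by
      linear_combination (-(M i j)) * hab
    by_cases h : i = j
    · simpa [mzr, h] using (by rw [h] at e; exact e.le)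
    · simp only [mzr, h, Matrix.of_apply, if_false, Matrix.add_apply, Matrix.smul_apply,
        smul_eq_mul]
      rw [e]
      refine (abs_add_le _ _).trans ?_
      rw [abs_mul, abs_mul, abs_of_nonneg ha, abs_of_nonneg hb]
  have h4 : a * w i + b * w i = w i := by rw [← add_mul, hab, one_mul]
  linarith

lemma mzr_closed {n : ℕ} (M N : Matrix (Fin n) (Fin n) ℝ) (v w : Fin n → ℝ) :
    IsClosed {κ : ℝ | (mzr (M + κ • N)).mulVec v ≤ w} := by
  refine isClosed_le ?_ continuous_const
  refine continuous_pi fun i => ?_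
  simp only [Matrix.mulVec, dotProduct]
  refine continuous_finsetSum _ fun j _ => ?_
  refine Continuous.mul ?_ continuous_const
  by_cases h : i = j
  · simp only [mzr, h, Matrix.of_apply, if_true, Matrix.add_apply, Matrix.smul_apply, smul_eq_mul]
    fun_prop
  · simp only [mzr, h, Matrix.of_apply, if_false, Matrix.add_apply, Matrix.smul_apply, smul_eq_mul]
    fun_prop

theorem stmt17
    {n m : ℕ} (hn : 0 < n)
    (A : Matrix (Fin n) (Fin n) ℝ) (B : Matrix (Fin n) (Fin m) ℝ)
    (K : Matrix (Fin m) (Fin n) ℝ)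
    (ξ η : Fin n → ℝ) (hξ : ξ ≠ 0) (hη : η ≠ 0)
    (φ : ℝ → ℝ) (hφ : ContDiff ℝ 1 φ) (hφ0 : φ 0 = 0)
    (R₀ : ℝ) (hR₀ : 0 < R₀)
    (κmin κmax : ℝ)
    (hκmin : IsGLB (deriv φ '' Set.Ioo (-R₀) R₀) κmin)
    (hκmax : IsLUB (deriv φ '' Set.Ioo (-R₀) R₀) κmax)
    (θ : Fin n → ℝ) (hθ : ∀ i, 0 < θ i) (c : ℝ) (hc : 0 < c) :
    (∀ x : Fin n → ℝ, -R₀ < η ⬝ᵥ x → η ⬝ᵥ x < R₀ →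
      logNorm (fun y => winf θ y)
        (jacobian (fun y => (A + B * K).mulVec y + φ (η ⬝ᵥ y) • ξ) x) ≤ -c)
    ↔
    ((mzr ((A + B * K) + κmin • Matrix.vecMulVec ξ η)).mulVec (fun i => (θ i)⁻¹)
        ≤ (-c) • (fun i => (θ i)⁻¹) ∧
      (mzr ((A + B * K) + κmax • Matrix.vecMulVec ξ η)).mulVec (fun i => (θ i)⁻¹)
        ≤ (-c) • (fun i => (θ i)⁻¹)) := by
  have hne : (deriv φ '' Set.Ioo (-R₀) R₀).Nonempty :=
    ⟨_, 0, ⟨by linarith, hR₀⟩, rfl⟩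
  simp only [jacobian_lure _ _ _ _ hφ, logNorm_le_iff hn θ hθ]
  constructor
  · intro h
    have hsub : deriv φ '' Set.Ioo (-R₀) R₀ ⊆
        {κ : ℝ | (mzr ((A + B * K) + κ • Matrix.vecMulVec ξ η)).mulVec (fun i => (θ i)⁻¹)
          ≤ (-c) • (fun i => (θ i)⁻¹)} := by
      rintro _ ⟨z, hz, rfl⟩
      have hηη : η ⬝ᵥ η ≠ 0 := by
        rwa [Ne, dotProduct_self_eq_zero]
      have hx : η ⬝ᵥ ((z / (η ⬝ᵥ η)) • η) = z := by
        rw [dotProduct_smul, smul_eq_mul, div_mul_cancel₀ _ hηη]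
      have := h ((z / (η ⬝ᵥ η)) • η)
      rw [hx] at this
      exact this hz.1 hz.2
    have hcl := closure_minimal hsub (mzr_closed _ _ _ _)
    exact ⟨hcl (hκmin.mem_closure hne), hcl (hκmax.mem_closure hne)⟩
  · rintro ⟨h1, h2⟩ x hx1 hx2
    have hmem : deriv φ (η ⬝ᵥ x) ∈ deriv φ '' Set.Ioo (-R₀) R₀ := ⟨_, ⟨hx1, hx2⟩, rfl⟩
    have hconv := mzr_convex (A + B * K) (Matrix.vecMulVec ξ η) (fun i => (θ i)⁻¹)
      ((-c) • (fun i => (θ i)⁻¹)) (fun i => inv_nonneg.2 (hθ i).le)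
    exact hconv.ordConnected.out h1 h2 ⟨hκmin.1 hmem, hκmax.1 hmem⟩

end
end

section
/- Let κ := max{|κ_min|, |κ_max|} and define d₂ := ‖A+BK‖_{∞,[θ]} + κ‖ξ‖_{∞,[θ]}‖η‖_{1,[θ]⁻¹}, where ‖A+BK‖_{∞,[θ]} is the matrix norm induced by ‖·‖_{∞,[θ]} and ‖η‖_{1,[θ]⁻¹} := ‖[θ]⁻¹η‖₁. Then ‖(A+BK)x + ξφ(ηᵀx)‖_{∞,[θ]} ≤ d₂‖x‖_{∞,[θ]} for all x ∈ C_η. -/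
set_option autoImplicit false

open Filter Set Real Matrix
open scoped Topology ENNReal

noncomputable section

theorem winf_nonneg' {n : ℕ} (θ x : Fin n → ℝ) : 0 ≤ winf θ x := norm_nonneg _

theorem winf_add_le' {n : ℕ} (θ x y : Fin n → ℝ) : winf θ (x + y) ≤ winf θ x + winf θ y := by
  unfold winf
  refine le_trans (le_of_eq ?_) (norm_add_le _ _)
  congr 1
  funext i
  simp [mul_add]

theorem winf_smul' {n : ℕ} (θ x : Fin n → ℝ) (c : ℝ) : winf θ (c • x) = |c| * winf θ x := by
  unfold winf
  rw [← Real.norm_eq_abs, ← norm_smul]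
  congr 1
  funext i
  simp only [Pi.smul_apply, smul_eq_mul]
  ring

theorem coord_le' {n : ℕ} (θ x : Fin n → ℝ) (hθ : ∀ i, 0 < θ i) (i : Fin n) :
    |x i| ≤ (θ i)⁻¹ * winf θ x := by
  have h : ‖θ i * x i‖ ≤ winf θ x := norm_le_pi_norm (fun i => θ i * x i : Fin n → ℝ) i
  rw [Real.norm_eq_abs, abs_mul, abs_of_pos (hθ i)] at h
  rw [inv_mul_eq_div, le_div_iff₀ (hθ i)]
  linarith

theorem dot_le' {n : ℕ} (θ η x : Fin n → ℝ) (hθ : ∀ i, 0 < θ i) :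
    |η ⬝ᵥ x| ≤ (∑ i, |(θ i)⁻¹ * η i|) * winf θ x := by
  unfold dotProduct
  refine (Finset.abs_sum_le_sum_abs _ _).trans ?_
  rw [Finset.sum_mul]
  refine Finset.sum_le_sum fun i _ => ?_
  rw [abs_mul, abs_mul, abs_of_pos (inv_pos.2 (hθ i))]
  have := mul_le_mul_of_nonneg_left (coord_le' θ x hθ i) (abs_nonneg (η i))
  linarith

theorem matNorm_bound' {n : ℕ} (θ : Fin n → ℝ) (hθ : ∀ i, 0 < θ i)
    (M : Matrix (Fin n) (Fin n) ℝ) (x : Fin n → ℝ) :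
    winf θ (M.mulVec x) ≤ matNorm (fun y => winf θ y) M * winf θ x := by
  have hb : BddAbove {c : ℝ | ∃ x : Fin n → ℝ, winf θ x = 1 ∧ c = winf θ (M.mulVec x)} := by
    refine ⟨∑ i, θ i * ∑ j, |(θ j)⁻¹ * M i j|, ?_⟩
    rintro c ⟨y, hy, rfl⟩
    have hnn : ∀ i, 0 ≤ θ i * ∑ j, |(θ j)⁻¹ * M i j| := fun i =>
      mul_nonneg (hθ i).le (Finset.sum_nonneg fun j _ => abs_nonneg _)
    refine (pi_norm_le_iff_of_nonneg (Finset.sum_nonneg fun i _ => hnn i)).2 fun i => ?_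
    refine le_trans ?_ (Finset.single_le_sum (fun i _ => hnn i) (Finset.mem_univ i))
    rw [Real.norm_eq_abs, abs_mul, abs_of_pos (hθ i)]
    refine mul_le_mul_of_nonneg_left ?_ (hθ i).le
    have := dot_le' θ (M i) y hθ
    rw [hy, mul_one] at this
    exact this
  rcases (winf_nonneg' θ x).eq_or_lt with h0 | hpos
  · have hx : x = 0 := by
      funext i
      have := coord_le' θ x hθ i
      rw [← h0, mul_zero] at this
      exact abs_nonpos_iff.1 this
    subst hx
    rw [Matrix.mulVec_zero, ← h0, mul_zero]
  · have h1 : winf θ ((winf θ x)⁻¹ • x) = 1 := by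
      rw [winf_smul', abs_of_pos (inv_pos.2 hpos), inv_mul_cancel₀ hpos.ne']
    have h2 : winf θ (M.mulVec ((winf θ x)⁻¹ • x)) ≤ matNorm (fun y => winf θ y) M :=
      le_csSup hb ⟨_, h1, rfl⟩
    rw [Matrix.mulVec_smul, winf_smul', abs_of_pos (inv_pos.2 hpos), inv_mul_eq_div,
      div_le_iff₀ hpos] at h2
    exact h2

theorem stmt19
    {n m : ℕ} (hn : 0 < n)
    (A : Matrix (Fin n) (Fin n) ℝ) (B : Matrix (Fin n) (Fin m) ℝ)
    (K : Matrix (Fin m) (Fin n) ℝ)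
    (ξ η : Fin n → ℝ) (hξ : ξ ≠ 0) (hη : η ≠ 0)
    (φ : ℝ → ℝ) (hφ : ContDiff ℝ 1 φ) (hφ0 : φ 0 = 0)
    (R₀ : ℝ) (hR₀ : 0 < R₀)
    (κmin κmax : ℝ)
    (hκmin : IsGLB (deriv φ '' Set.Ioo (-R₀) R₀) κmin)
    (hκmax : IsLUB (deriv φ '' Set.Ioo (-R₀) R₀) κmax)
    (θ : Fin n → ℝ) (hθ : ∀ i, 0 < θ i)
    (κ : ℝ) (hκ : κ = max |κmin| |κmax|)
    (d₂ : ℝ) (hd₂ : d₂ = matNorm (fun y => winf θ y) (A + B * K) +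
      κ * winf θ ξ * ∑ i : Fin n, |(θ i)⁻¹ * η i|) :
    ∀ x : Fin n → ℝ, -R₀ < η ⬝ᵥ x → η ⬝ᵥ x < R₀ →
      winf θ ((A + B * K).mulVec x + φ (η ⬝ᵥ x) • ξ) ≤ d₂ * winf θ x := by
  intro x h1 h2
  have hder : ∀ z ∈ Set.Ioo (-R₀) R₀, ‖deriv φ z‖ ≤ κ := by
    intro z hz
    have a := hκmin.1 (Set.mem_image_of_mem _ hz)
    have b := hκmax.1 (Set.mem_image_of_mem _ hz)
    rw [hκ, Real.norm_eq_abs]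
    exact abs_le_max_abs_abs a b
  have hdiff : Differentiable ℝ φ := hφ.differentiable (by norm_num)
  have hφb : |φ (η ⬝ᵥ x)| ≤ κ * |η ⬝ᵥ x| := by
    have := (convex_Ioo (-R₀) R₀).norm_image_sub_le_of_norm_deriv_le
      (fun z _ => hdiff z) hder (x := 0) (y := η ⬝ᵥ x) ⟨by linarith, hR₀⟩ ⟨h1, h2⟩
    simpa [hφ0] using this
  have hκ0 : 0 ≤ κ := by rw [hκ]; exact le_max_of_le_left (abs_nonneg _)
  have h3 : |φ (η ⬝ᵥ x)| ≤ κ * ((∑ i, |(θ i)⁻¹ * η i|) * winf θ x) :=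
    hφb.trans (mul_le_mul_of_nonneg_left (dot_le' θ η x hθ) hκ0)
  have h4 := mul_le_mul_of_nonneg_right h3 (winf_nonneg' θ ξ)
  have h5 := winf_add_le' θ ((A + B * K).mulVec x) (φ (η ⬝ᵥ x) • ξ)
  have h6 := matNorm_bound' θ hθ (A + B * K) x
  rw [winf_smul'] at h5
  rw [hd₂]
  linarith

end
end
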